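/- arXiv:2104.06704 — 5 statements merged into one kernel-verified Lean document; each statement's English description precedes it below -/
import Mathlib

section
/- Let V_{x₁} and V_{ξ₁} be bounded open intervals in ℝ, let ε > 0, and set Ω = V_{x₁} × V_{ξ₁} × B(0,ε) ⊂ ℝ⁴, where ℝ⁴ carries coordinates (x₁, ξ₁, x₂, ξ₂) and B(0,ε) is the open Euclidean ball of radius ε centered at the origin in the (x₂, ξ₂)-plane. Let q(x₂, ξ₂) = (x₂² + ξ₂²)/2, and let r, s ∈ C^∞(Ω; ℝ) satisfy {s, ξ₁} = {r, q} on Ω. Then there exist ν ∈ C^∞(Ω; ℝ) and ψ ∈ C^∞(V_{ξ₁} × (−ε²/2, ε²/2); ℝ) such that on Ω: {ξ₁, ν} + r = 0 and {q, ν} + s + ψ(ξ₁, q) = 0, where ψ(ξ₁, q) denotes the function (x₁, ξ₁, x₂, ξ₂) ↦ ψ(ξ₁, q(x₂, ξ₂)). Moreover, if r = r_E and s = s_E depend smoothly on an additional real parameter E, then the solutions ν and ψ can be chosen to depend smoothly on E. -/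
open Set

noncomputable section

/-- Phase space `ℝ⁴` with coordinates `(x₁, ξ₁, x₂, ξ₂)`. -/
abbrev P4 : Type := ℝ × ℝ × ℝ × ℝ

/-- Partial derivative with respect to `x₁`. -/
noncomputable def pdx₁ (f : P4 → ℝ) (p : P4) : ℝ :=
  deriv (fun t => f (t, p.2.1, p.2.2.1, p.2.2.2)) p.1

/-- Partial derivative with respect to `ξ₁`. -/
noncomputable def pdxi₁ (f : P4 → ℝ) (p : P4) : ℝ :=
  deriv (fun t => f (p.1, t, p.2.2.1, p.2.2.2)) p.2.1

/-- Partial derivative with respect to `x₂`. -/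
noncomputable def pdx₂ (f : P4 → ℝ) (p : P4) : ℝ :=
  deriv (fun t => f (p.1, p.2.1, t, p.2.2.2)) p.2.2.1

/-- Partial derivative with respect to `ξ₂`. -/
noncomputable def pdxi₂ (f : P4 → ℝ) (p : P4) : ℝ :=
  deriv (fun t => f (p.1, p.2.1, p.2.2.1, t)) p.2.2.2

/-- The Poisson bracket `{f, g} = Σᵢ (∂_{ξᵢ}f ∂_{xᵢ}g − ∂_{xᵢ}f ∂_{ξᵢ}g)` associated with the
symplectic form `dξ₁ ∧ dx₁ + dξ₂ ∧ dx₂`. -/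
noncomputable def poisson (f g : P4 → ℝ) (p : P4) : ℝ :=
  pdxi₁ f p * pdx₁ g p - pdx₁ f p * pdxi₁ g p
    + pdxi₂ f p * pdx₂ g p - pdx₂ f p * pdxi₂ g p

/-- The elliptic Hamiltonian `q(x₂, ξ₂) = (x₂² + ξ₂²)/2`. -/
def qfun : P4 → ℝ := fun p => (p.2.2.1 ^ 2 + p.2.2.2 ^ 2) / 2

/-- The coordinate function `ξ₁`. -/
def xi₁fun : P4 → ℝ := fun p => p.2.1



theorem hasFDerivAt_param_aux {E F : Type} [NormedAddCommGroup E] [NormedSpace ℝ E]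
    [NormedAddCommGroup F] [NormedSpace ℝ F] {W : Set (E × ℝ)} (hW : IsOpen W)
    {f : E × ℝ → F} (hf : ContDiffOn ℝ 1 f W) {a b : ℝ} {x₀ : E}
    (hx : ∀ t ∈ uIcc a b, (x₀, t) ∈ W) :
    HasFDerivAt (fun x => ∫ t in a..b, f (x, t))
      (∫ t in a..b, (fderiv ℝ f (x₀, t)).comp (ContinuousLinearMap.inl ℝ E ℝ)) x₀ := by
  set f' : E × ℝ → (E →L[ℝ] F) := fun z => (fderiv ℝ f z).comp (ContinuousLinearMap.inl ℝ E ℝ)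
    with hf'
  have hf'c : ContinuousOn f' W := by
    have h1 : ContinuousOn (fderiv ℝ f) W := hf.continuousOn_fderiv_of_isOpen hW le_rfl
    exact h1.clm_comp continuousOn_const
  have hcomp : IsCompact (({x₀} : Set E) ×ˢ uIcc a b) := isCompact_singleton.prod isCompact_uIcc
  have hsub : (({x₀} : Set E) ×ˢ uIcc a b) ⊆ W := by
    rintro ⟨x, t⟩ ⟨h1, h2⟩
    obtain rfl : x = x₀ := h1
    exact hx t h2
  obtain ⟨M, hM⟩ := hcomp.exists_bound_of_continuousOn (hf'c.mono hsub)
  have hopen : IsOpen (W ∩ (fun z => ‖f' z‖) ⁻¹' Iio (M + 1)) :=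
    hf'c.norm.isOpen_inter_preimage hW isOpen_Iio
  obtain ⟨u, v, hu, hv, hxu, hv', huv⟩ := generalized_tube_lemma
    (isCompact_singleton (x := x₀)) (isCompact_uIcc (a := a) (b := b)) hopen (by
      intro z hz
      refine ⟨hsub hz, ?_⟩
      have := hM z hz
      simp only [mem_preimage, mem_Iio]
      linarith)
  have hu0 : u ∈ nhds x₀ := hu.mem_nhds (hxu rfl)
  have hcont : ∀ x ∈ u, ContinuousOn (fun t => f (x, t)) (uIcc a b) := by
    intro x hx
    refine hf.continuousOn.comp (by fun_prop) ?_
    intro t ht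
    exact (huv (Set.mk_mem_prod hx (hv' ht))).1
  have hcont' : ContinuousOn (fun t => f' (x₀, t)) (uIcc a b) := by
    refine hf'c.comp (by fun_prop) ?_
    intro t ht
    exact hx t ht
  refine intervalIntegral.hasFDerivAt_integral_of_dominated_of_fderiv_le
    (F := fun x t => f (x, t)) (F' := fun x t => f' (x, t)) (bound := fun _ => M + 1) hu0 ?_ ?_ ?_ ?_ ?_ ?_
  · filter_upwards [hu0] with x hx
    exact ((hcont x hx).mono uIoc_subset_uIcc).aestronglyMeasurable measurableSet_uIoc
  · exact (hcont x₀ (hxu rfl)).intervalIntegrable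
  · exact (hcont'.mono uIoc_subset_uIcc).aestronglyMeasurable measurableSet_uIoc
  · refine Filter.Eventually.of_forall fun t ht x hx => ?_
    exact le_of_lt (huv (Set.mk_mem_prod hx (hv' (uIoc_subset_uIcc ht)))).2
  · exact intervalIntegrable_const
  · refine Filter.Eventually.of_forall fun t ht x hx => ?_
    have hmem := (huv (Set.mk_mem_prod hx (hv' (uIoc_subset_uIcc ht)))).1
    have h1 : HasFDerivAt f (fderiv ℝ f (x, t)) (x, t) :=
      ((hf.differentiableOn one_ne_zero).differentiableAt (hW.mem_nhds hmem)).hasFDerivAt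
    exact h1.comp x (hasFDerivAt_prodMk_left x t)

theorem contDiffOn_param_nat {E : Type} [NormedAddCommGroup E] [NormedSpace ℝ E]
    {W : Set (E × ℝ)} (hW : IsOpen W) {a b : ℝ} {s : Set E} (hs : IsOpen s)
    (hsW : ∀ x ∈ s, ∀ t ∈ uIcc a b, (x, t) ∈ W) (n : ℕ) :
    ∀ {F : Type} [NormedAddCommGroup F] [NormedSpace ℝ F] {f : E × ℝ → F}
      (_ : ContDiffOn ℝ (⊤ : ℕ∞) f W),
    ContDiffOn ℝ n (fun x => ∫ t in a..b, f (x, t)) s := by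
  induction n with
  | zero =>
    intro F _ _ f hf
    refine contDiffOn_zero.2 fun x hx => ?_
    exact (hasFDerivAt_param_aux hW (hf.of_le (by exact_mod_cast le_top))
      (hsW x hx)).continuousAt.continuousWithinAt
  | succ n ih =>
    intro F _ _ f hf
    have hf1 : ContDiffOn ℝ 1 f W := hf.of_le (by exact_mod_cast le_top)
    have : ((n + 1 : ℕ) : WithTop ℕ∞) = (n : WithTop ℕ∞) + 1 := by norm_cast
    rw [this, contDiffOn_succ_iff_hasFDerivWithinAt_of_uniqueDiffOn hs.uniqueDiffOn]
    refine ⟨by simp, _, ?_, fun x hx => (hasFDerivAt_param_aux hW hf1 (hsW x hx)).hasFDerivWithinAt⟩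
    apply ih (f := fun z => (fderiv ℝ f z).comp (ContinuousLinearMap.inl ℝ E ℝ))
    have h1 : ContDiffOn ℝ (⊤ : ℕ∞) (fderiv ℝ f) W := hf.fderiv_of_isOpen hW (by norm_cast)
    exact h1.clm_comp contDiffOn_const

theorem contDiffOn_param {E : Type} [NormedAddCommGroup E] [NormedSpace ℝ E]
    {W : Set (E × ℝ)} (hW : IsOpen W) {a b : ℝ} {s : Set E} (hs : IsOpen s)
    (hsW : ∀ x ∈ s, ∀ t ∈ uIcc a b, (x, t) ∈ W)
    {F : Type} [NormedAddCommGroup F] [NormedSpace ℝ F] {f : E × ℝ → F}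
      (hf : ContDiffOn ℝ (⊤ : ℕ∞) f W) :
    ContDiffOn ℝ (⊤ : ℕ∞) (fun x => ∫ t in a..b, f (x, t)) s :=
  contDiffOn_infty.2 fun n => contDiffOn_param_nat hW hs hsW n hf

open MeasureTheory in
theorem contDiff_dominated_nat {E T : Type} [NormedAddCommGroup E] [NormedSpace ℝ E]
    [NormedAddCommGroup T] [NormedSpace ℝ T] [FiniteDimensional ℝ E] [FiniteDimensional ℝ T]
    [MeasurableSpace T] [BorelSpace T] (μ : Measure T) (n : ℕ) :
    ∀ {F : Type} [NormedAddCommGroup F] [NormedSpace ℝ F] {f : E × T → F}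
      (_ : ContDiff ℝ (⊤ : ℕ∞) f)
      (_ : ∀ m : ℕ, ∃ v : T → ℝ, Integrable v μ ∧
        ∀ t x, ‖iteratedFDeriv ℝ m (fun x => f (x, t)) x‖ ≤ v t),
    ContDiff ℝ n (fun x => ∫ t, f (x, t) ∂μ) := by
  have key : ∀ {F : Type} [NormedAddCommGroup F] [NormedSpace ℝ F] {f : E × T → F}
      (_ : ContDiff ℝ (⊤ : ℕ∞) f)
      (_ : ∀ m : ℕ, ∃ v : T → ℝ, Integrable v μ ∧
        ∀ t x, ‖iteratedFDeriv ℝ m (fun x => f (x, t)) x‖ ≤ v t) (x₀ : E),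
      HasFDerivAt (fun x => ∫ t, f (x, t) ∂μ)
        (∫ t, (fderiv ℝ f (x₀, t)).comp (ContinuousLinearMap.inl ℝ E T) ∂μ) x₀ := by
    intro F _ _ f hf hb x₀
    have hd : ∀ t x, HasFDerivAt (fun x => f (x, t))
        ((fderiv ℝ f (x, t)).comp (ContinuousLinearMap.inl ℝ E T)) x := fun t x =>
      ((hf.differentiable (by simp)) (x, t)).hasFDerivAt.comp x (hasFDerivAt_prodMk_left x t)
    obtain ⟨v0, hv0, hb0⟩ := hb 0
    obtain ⟨v1, hv1, hb1⟩ := hb 1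
    have hfc := hf.continuous
    have hfc' : Continuous (fderiv ℝ f) := hf.continuous_fderiv (by simp)
    refine hasFDerivAt_integral_of_dominated_of_fderiv_le (F := fun x t => f (x, t))
      (F' := fun x t => (fderiv ℝ f (x, t)).comp (ContinuousLinearMap.inl ℝ E T))
      (bound := v1) (s := univ) Filter.univ_mem ?_ ?_ ?_ ?_ hv1 ?_
    · exact Filter.Eventually.of_forall fun x =>
        Continuous.aestronglyMeasurable (by fun_prop)
    · refine hv0.mono' (Continuous.aestronglyMeasurable (by fun_prop)) ?_
      refine Filter.Eventually.of_forall fun t => ?_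
      simpa using hb0 t x₀
    · exact Continuous.aestronglyMeasurable (by fun_prop)
    · refine Filter.Eventually.of_forall fun t x _ => ?_
      have := hb1 t x
      rw [← norm_fderiv_iteratedFDeriv] at this
      rw [← (hd t x).fderiv]
      have h2 := hb1 t x
      rwa [norm_iteratedFDeriv_one] at h2
    · exact Filter.Eventually.of_forall fun t x _ => hd t x
  induction n with
  | zero =>
    intro F _ _ f hf hb
    refine contDiff_zero.2 (continuous_iff_continuousAt.2 fun x => (key hf hb x).continuousAt)
  | succ n ih =>
    intro F _ _ f hf hb
    have : ((n + 1 : ℕ) : WithTop ℕ∞) = (n : WithTop ℕ∞) + 1 := by norm_cast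
    rw [this, contDiff_succ_iff_hasFDerivAt]
    refine ⟨_, ?_, fun x => key hf hb x⟩
    apply ih (f := fun z => (fderiv ℝ f z).comp (ContinuousLinearMap.inl ℝ E T))
    · have h1 : ContDiff ℝ (⊤ : ℕ∞) (fderiv ℝ f) := hf.fderiv_right (by norm_cast)
      exact h1.clm_comp contDiff_const
    · intro m
      obtain ⟨v, hv, hb⟩ := hb (m + 1)
      refine ⟨v, hv, fun t x => ?_⟩
      have hd : ∀ x, HasFDerivAt (fun x => f (x, t))
        ((fderiv ℝ f (x, t)).comp (ContinuousLinearMap.inl ℝ E T)) x := fun x =>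
        ((hf.differentiable (by simp)) (x, t)).hasFDerivAt.comp x (hasFDerivAt_prodMk_left x t)
      have h2 := hb t x
      rw [← norm_iteratedFDeriv_fderiv] at h2
      convert h2 using 3
      ext1 y
      exact (hd y).fderiv.symm

open Manifold in
theorem exists_glue {E : Type} [NormedAddCommGroup E] [NormedSpace ℝ E] [FiniteDimensional ℝ E]
    {U : Set E} (hU : IsOpen U) (t : E → Set ℝ) (ht : ∀ x, Convex ℝ (t x))
    (hloc : ∀ x ∈ U, ∃ V ∈ nhds x, ∃ g : E → ℝ, ContDiffOn ℝ (⊤ : ℕ∞) g V ∧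
      ∀ y ∈ V, y ∈ U → g y ∈ t y) :
    ∃ g : E → ℝ, ContDiffOn ℝ (⊤ : ℕ∞) g U ∧ ∀ x ∈ U, g x ∈ t x := by
  classical
  let O : TopologicalSpace.Opens E := ⟨U, hU⟩
  have : LocallyCompactSpace O := hU.locallyCompactSpace
  have : SigmaCompactSpace O := inferInstance
  obtain ⟨g, hg⟩ := exists_contMDiffMap_forall_mem_convex_of_local (𝓘(ℝ, E)) (M := O)
    (n := (⊤ : ℕ∞)) (t := fun x : O => t x) (fun x => ht x) (by
      intro x
      obtain ⟨V, hV, g, hg, hgt⟩ := hloc x.1 x.2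
      refine ⟨Subtype.val ⁻¹' V, continuous_subtype_val.continuousAt hV, fun y => g y, ?_, ?_⟩
      · exact hg.contMDiffOn.comp contMDiff_subtype_val.contMDiffOn (fun y hy => hy)
      · exact fun y hy => hgt y hy y.2)
  refine ⟨fun x => if h : x ∈ U then g ⟨x, h⟩ else 0, ?_, ?_⟩
  · intro x hx
    refine ContDiffAt.contDiffWithinAt ?_
    rw [← contMDiffAt_iff_contDiffAt]
    have := (contMDiffAt_subtype_iff (I := 𝓘(ℝ, E)) (I' := 𝓘(ℝ, ℝ)) (n := (⊤ : ℕ∞)) (U := O)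
      (f := fun x => if h : x ∈ U then g ⟨x, h⟩ else 0) (x := ⟨x, hx⟩)).1 (by
        have h := g.contMDiff ⟨x, hx⟩
        refine h.congr_of_eventuallyEq (Filter.Eventually.of_forall fun y => ?_)
        have : (y : E) ∈ U := y.2
        simp [this])
    exact this
  · intro x hx
    simp only [hx, dif_pos]
    exact hg ⟨x, hx⟩

noncomputable def cosSqrt (z : ℝ) : ℝ :=
  FormalMultilinearSeries.ofScalarsSum (E := ℝ) (fun n : ℕ => ((-1 : ℝ) ^ n / (2 * n).factorial)) z

theorem cosSqrt_sq (x : ℝ) : cosSqrt (x ^ 2) = Real.cos x := by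
  unfold cosSqrt
  rw [FormalMultilinearSeries.ofScalarsSum_eq_tsum, ← (Real.hasSum_cos x).tsum_eq]
  refine tsum_congr fun n => ?_
  rw [← pow_mul, smul_eq_mul]
  ring

theorem cosSqrt_contDiff : ContDiff ℝ (⊤ : ℕ∞) cosSqrt := by
  set c : ℕ → ℝ := (fun n : ℕ => ((-1 : ℝ) ^ n / (2 * n).factorial)) with hc
  have hr : (FormalMultilinearSeries.ofScalars ℝ c).radius = ⊤ := by
    apply FormalMultilinearSeries.ofScalars_radius_eq_top_of_tendsto
    · exact Filter.Eventually.of_forall fun n => by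
        simp only [hc]; positivity
    · have h1 : ∀ n : ℕ, ‖c n.succ‖ / ‖c n‖ = 1 / ((2 * n + 1) * (2 * n + 2)) := by
        intro n
        simp only [hc, norm_div, norm_pow, norm_neg, norm_one, one_pow, Nat.succ_eq_add_one,
          Real.norm_natCast]
        rw [show 2 * (n + 1) = (2 * n + 1) + 1 by ring, Nat.factorial_succ, Nat.factorial_succ]
        have : ((2 * n).factorial : ℝ) ≠ 0 := by positivity
        push_cast
        field_simp
        ring
      simp_rw [h1]
      refine squeeze_zero (fun n => by positivity) (fun n => ?_)
        tendsto_one_div_add_atTop_nhds_zero_nat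
      apply one_div_le_one_div_of_le (by positivity)
      have : (0 : ℝ) ≤ n := by positivity
      nlinarith
  have h := (FormalMultilinearSeries.ofScalars ℝ c).hasFPowerSeriesOnBall (by rw [hr]; simp)
  rw [hr] at h
  have h2 : AnalyticOnNhd ℝ cosSqrt univ := by
    intro z _
    exact h.analyticAt_of_mem (by simp)
  exact contDiffOn_univ.1 (h2.contDiffOn uniqueDiffOn_univ)

theorem cosSqrt_ode (n : ℕ) : ∀ z : ℝ, 0 < z →
    4 * z * iteratedDeriv (n + 2) cosSqrt z + (4 * n + 2) * iteratedDeriv (n + 1) cosSqrt z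
      + iteratedDeriv n cosSqrt z = 0 := by
  have hD : ∀ (n : ℕ) (z : ℝ), HasDerivAt (iteratedDeriv n cosSqrt) (iteratedDeriv (n + 1) cosSqrt z) z := by
    intro n z
    rw [iteratedDeriv_succ]
    exact ((cosSqrt_contDiff.differentiable_iteratedDeriv n (by exact_mod_cast ENat.natCast_lt_top n)) z).hasDerivAt
  induction n with
  | zero =>
    intro z hz
    obtain ⟨x, hx, rfl⟩ : ∃ x : ℝ, 0 < x ∧ z = x ^ 2 := ⟨√z, by positivity, (Real.sq_sqrt hz.le).symm⟩
    have hsq : ∀ x : ℝ, HasDerivAt (fun x : ℝ => x ^ 2) (2 * x) x := fun x => by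
      simpa using hasDerivAt_pow 2 x
    have h1 : ∀ x : ℝ, iteratedDeriv 1 cosSqrt (x ^ 2) * (2 * x) = - Real.sin x := by
      intro x
      have h := (hD 0 (x ^ 2)).comp x (hsq x)
      have h' : HasDerivAt (iteratedDeriv 0 cosSqrt ∘ fun x => x ^ 2) (- Real.sin x) x := by
        have : (iteratedDeriv 0 cosSqrt ∘ fun x => x ^ 2) = Real.cos := by
          ext y; simp [cosSqrt_sq]
        rw [this]; exact Real.hasDerivAt_cos x
      exact h.unique h'
    have h2 : iteratedDeriv 2 cosSqrt (x ^ 2) * (2 * x) * (2 * x) + iteratedDeriv 1 cosSqrt (x ^ 2) * 2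
        = - Real.cos x := by
      have h := ((hD 1 (x ^ 2)).comp x (hsq x)).mul ((hasDerivAt_id x).const_mul 2)
      have h' : HasDerivAt ((iteratedDeriv 1 cosSqrt ∘ fun x => x ^ 2) * fun y => 2 * id y) (- Real.cos x) x := by
        have : ((iteratedDeriv 1 cosSqrt ∘ fun x => x ^ 2) * fun y => 2 * id y) = fun x => - Real.sin x := by
          ext y; exact h1 y
        rw [this]; exact (Real.hasDerivAt_sin x).neg
      have := h.unique h'
      simpa using this
    have h0 : iteratedDeriv 0 cosSqrt (x ^ 2) = Real.cos x := by simp [cosSqrt_sq]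
    simp only [zero_add, h0, Nat.cast_zero]
    linarith
  | succ n ih =>
    intro z hz
    have h := ((((hasDerivAt_id z).const_mul 4).mul (hD (n + 2) z)).add
      ((hD (n + 1) z).const_mul (4 * n + 2 : ℝ))).add (hD n z)
    have h' := h.congr_of_eventuallyEq (f₁ := fun _ => 0) (by
      filter_upwards [lt_mem_nhds hz] with y hy
      simpa using (ih y hy).symm)
    have := h'.unique (hasDerivAt_const z 0)
    push_cast
    simp at this
    linarith

theorem cosSqrt_bound (n : ℕ) : ∃ M, ∀ z : ℝ, 1 ≤ z → |iteratedDeriv n cosSqrt z| ≤ M := by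
  have h0 : ∀ z : ℝ, 0 ≤ z → cosSqrt z = Real.cos √z := by
    intro z hz; rw [← cosSqrt_sq, Real.sq_sqrt hz]
  induction n using Nat.strong_induction_on with
  | _ n ih =>
    match n with
    | 0 =>
      refine ⟨1, fun z hz => ?_⟩
      rw [iteratedDeriv_zero, h0 z (by linarith)]
      exact Real.abs_cos_le_one _
    | 1 =>
      refine ⟨1, fun z hz => ?_⟩
      have h := ((Real.hasDerivAt_sqrt (x := z) (by positivity)).cos)
      have h' := h.congr_of_eventuallyEq (f₁ := cosSqrt) (by
        filter_upwards [lt_mem_nhds (show 0 < z by linarith)] with y hy using h0 y hy.le)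
      rw [iteratedDeriv_one, h'.deriv, abs_mul, abs_neg]
      have h1 : 1 ≤ √z := by rw [Real.one_le_sqrt]; exact hz
      have h2 : |1 / (2 * √z)| ≤ 1 := by
        rw [abs_of_pos (by positivity), div_le_one (by positivity)]; linarith
      have := Real.abs_sin_le_one √z
      calc _ ≤ (1 : ℝ) * 1 := by gcongr
        _ = 1 := by norm_num
    | (n + 2) =>
      obtain ⟨M, hM⟩ := ih n (by omega)
      obtain ⟨M', hM'⟩ := ih (n + 1) (by omega)
      refine ⟨(4 * n + 2) * M' + M, fun z hz => ?_⟩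
      have h := cosSqrt_ode n z (by linarith)
      have e : 4 * z * iteratedDeriv (n + 2) cosSqrt z = -((4 * n + 2) * iteratedDeriv (n + 1) cosSqrt z
        + iteratedDeriv n cosSqrt z) := by linarith
      have h1 : |4 * z * iteratedDeriv (n + 2) cosSqrt z| ≤ (4 * n + 2) * M' + M := by
        rw [e, abs_neg]
        refine (abs_add_le _ _).trans ?_
        rw [abs_mul, abs_of_nonneg (show (0 : ℝ) ≤ 4 * n + 2 by positivity)]
        gcongr
        · exact hM' z hz
        · exact hM z hz
      refine le_trans ?_ h1
      rw [abs_mul, abs_of_pos (by positivity : 0 < 4 * z)]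
      nlinarith [abs_nonneg (iteratedDeriv (n + 2) cosSqrt z)]

/-- a smooth function with bounded derivatives with value `cos x` at `x ^ 2`. -/
theorem exists_bounded_cos : ∃ D : ℝ → ℝ, ContDiff ℝ (⊤ : ℕ∞) D ∧ (∀ x, D (x ^ 2) = Real.cos x) ∧
    ∀ n : ℕ, ∃ M, ∀ z, ‖iteratedFDeriv ℝ n D z‖ ≤ M := by
  refine ⟨fun z => Real.smoothTransition (z + 2) * cosSqrt z, ?_, ?_, ?_⟩
  · exact (Real.smoothTransition.contDiff.comp (by fun_prop)).mul cosSqrt_contDiff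
  · intro x
    simp only
    rw [Real.smoothTransition.one_of_one_le (by nlinarith [sq_nonneg x]), cosSqrt_sq, one_mul]
  · intro n
    set D := fun z => Real.smoothTransition (z + 2) * cosSqrt z with hD
    have hDs : ContDiff ℝ (⊤ : ℕ∞) D :=
      (Real.smoothTransition.contDiff.comp (by fun_prop)).mul cosSqrt_contDiff
    obtain ⟨M, hM⟩ := cosSqrt_bound n
    have hc : Continuous (iteratedDeriv n D) := hDs.continuous_iteratedDeriv n (by exact_mod_cast le_top)
    obtain ⟨K, hK⟩ := (isCompact_Icc (a := (-3 : ℝ)) (b := 1)).exists_bound_of_continuousOn hc.continuousOn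
    refine ⟨max 0 (max M K), fun z => ?_⟩
    rw [norm_iteratedFDeriv_eq_norm_iteratedDeriv]
    rcases lt_or_ge z (-2) with h | h
    · have : D =ᶠ[nhds z] fun _ => 0 := by
        filter_upwards [gt_mem_nhds h] with y hy
        simp only [hD]
        rw [Real.smoothTransition.zero_of_nonpos (by linarith), zero_mul]
      rw [Filter.EventuallyEq.iteratedDeriv_eq n this]
      simp
    rcases le_or_gt z 1 with h1 | h1
    · exact (hK z ⟨by linarith, h1⟩).trans ((le_max_right _ _).trans (le_max_right _ _))
    · have : D =ᶠ[nhds z] cosSqrt := by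
        filter_upwards [lt_mem_nhds h1] with y hy
        simp only [hD]
        rw [Real.smoothTransition.one_of_one_le (by linarith), one_mul]
      rw [Filter.EventuallyEq.iteratedDeriv_eq n this]
      exact (hM z h1.le).trans ((le_max_left _ _).trans (le_max_right _ _))

theorem natCast_le_infty (k : ℕ) : (k : WithTop ℕ∞) ≤ ((⊤ : ℕ∞) : WithTop ℕ∞) := by
  exact_mod_cast le_top

theorem cexp_bound (n : ℕ) (u : ℝ) :
    ‖iteratedFDeriv ℝ n (fun u : ℝ => Complex.exp (u * Complex.I)) u‖ ≤ 1 := by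
  have h : ∀ n : ℕ, iteratedDeriv n (fun u : ℝ => Complex.exp (u * Complex.I)) =
      fun u : ℝ => Complex.I ^ n * Complex.exp (u * Complex.I) := by
    intro n
    induction n with
    | zero => simp
    | succ n ih =>
      rw [iteratedDeriv_succ, ih]
      ext u
      have h1 : HasDerivAt (fun u : ℝ => (u : ℂ) * Complex.I) (1 * Complex.I) u :=
        (Complex.ofRealCLM.hasDerivAt (x := u)).mul_const Complex.I
      have := (h1.cexp).const_mul (Complex.I ^ n)
      rw [this.deriv]
      ring
  rw [norm_iteratedFDeriv_eq_norm_iteratedDeriv, h]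
  simp [Complex.norm_exp_ofReal_mul_I]

abbrev V3 : Type := EuclideanSpace ℝ (Fin 3)

theorem exists_kernel : ∃ G : ℝ × ℝ → ℂ, ContDiff ℝ (⊤ : ℕ∞) G ∧
    (∀ u x, G (u, x ^ 2) = Complex.exp (u * Complex.I) * Real.cos x) ∧
    ∀ n : ℕ, ∃ M, 0 ≤ M ∧ ∀ z, ‖iteratedFDeriv ℝ n G z‖ ≤ M := by
  obtain ⟨D, hD, hDc, hDb⟩ := exists_bounded_cos
  have he : ContDiff ℝ (⊤ : ℕ∞) (fun u : ℝ => Complex.exp (u * Complex.I)) := by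
    have : ContDiff ℝ (⊤ : ℕ∞) (fun u : ℝ => (u : ℂ)) := Complex.ofRealCLM.contDiff
    exact (this.mul contDiff_const).cexp
  have h1 : ContDiff ℝ (⊤ : ℕ∞) (fun z : ℝ × ℝ => D z.2) := hD.comp contDiff_snd
  have h2 : ContDiff ℝ (⊤ : ℕ∞) (fun z : ℝ × ℝ => Complex.exp (z.1 * Complex.I)) :=
    he.comp contDiff_fst
  refine ⟨fun z => D z.2 • Complex.exp (z.1 * Complex.I), h1.smul h2, ?_, ?_⟩
  · intro u x
    simp only [hDc, Complex.real_smul]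
    ring
  · intro n
    choose M hM using hDb
    have hM0 : ∀ i, 0 ≤ M i := fun i => (norm_nonneg _).trans (hM i 0)
    refine ⟨∑ i ∈ Finset.range (n + 1), (n.choose i : ℝ) * M i * 1,
      Finset.sum_nonneg fun i _ => by have := hM0 i; positivity, fun z => ?_⟩
    refine (norm_iteratedFDeriv_smul_le h1 h2 z (n := n) (by exact_mod_cast le_top)).trans ?_
    refine Finset.sum_le_sum fun i _ => ?_
    have e1 : ‖iteratedFDeriv ℝ i (fun z : ℝ × ℝ => D z.2) z‖ ≤ M i := by
      have := (ContinuousLinearMap.snd ℝ ℝ ℝ).iteratedFDeriv_comp_right hD z (i := i) (by exact_mod_cast le_top)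
      have e : (fun z : ℝ × ℝ => D z.2) = D ∘ (ContinuousLinearMap.snd ℝ ℝ ℝ) := rfl
      rw [e, this]
      refine (ContinuousMultilinearMap.norm_compContinuousLinearMap_le _ _).trans ?_
      have hp : ∏ _j : Fin i, ‖ContinuousLinearMap.snd ℝ ℝ ℝ‖ ≤ 1 :=
        Finset.prod_le_one (fun _ _ => norm_nonneg _)
          (fun _ _ => ContinuousLinearMap.norm_snd_le ℝ ℝ ℝ)
      calc _ ≤ M i * 1 := mul_le_mul (hM i _) hp (by positivity) (hM0 i)
        _ = M i := mul_one _
    have e2 : ‖iteratedFDeriv ℝ (n - i) (fun z : ℝ × ℝ => Complex.exp (z.1 * Complex.I)) z‖ ≤ 1 := by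
      have := (ContinuousLinearMap.fst ℝ ℝ ℝ).iteratedFDeriv_comp_right he z (i := n - i)
        (natCast_le_infty _)
      have e : (fun z : ℝ × ℝ => Complex.exp (z.1 * Complex.I)) =
        (fun u : ℝ => Complex.exp (u * Complex.I)) ∘ (ContinuousLinearMap.fst ℝ ℝ ℝ) := rfl
      rw [e, this]
      refine (ContinuousMultilinearMap.norm_compContinuousLinearMap_le _ _).trans ?_
      have hp : ∏ _j : Fin (n - i), ‖ContinuousLinearMap.fst ℝ ℝ ℝ‖ ≤ 1 :=
        Finset.prod_le_one (fun _ _ => norm_nonneg _)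
          (fun _ _ => ContinuousLinearMap.norm_fst_le ℝ ℝ ℝ)
      calc _ ≤ (1 : ℝ) * 1 := mul_le_mul (cexp_bound _ _) hp (by positivity) (by norm_num)
        _ = 1 := mul_one _
    have := hM0 i
    gcongr

/-- the linear map used in the Fourier representation -/
noncomputable def lamMap (t : V3) : V3 →L[ℝ] ℝ × ℝ :=
  ((2 * Real.pi * t 0) • (EuclideanSpace.proj 0 : V3 →L[ℝ] ℝ)
    + (2 * Real.pi * t 1) • (EuclideanSpace.proj 1 : V3 →L[ℝ] ℝ)).prod
    ((2 * Real.pi * t 2) ^ 2 • (EuclideanSpace.proj 2 : V3 →L[ℝ] ℝ))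

theorem lamMap_apply (t x : V3) : lamMap t x =
    (2 * Real.pi * t 0 * x 0 + 2 * Real.pi * t 1 * x 1, (2 * Real.pi * t 2) ^ 2 * x 2) := by
  simp [lamMap]

theorem lamMap_norm (t : V3) : ‖lamMap t‖ ≤ 64 * (1 + ‖t‖) ^ 2 := by
  refine ContinuousLinearMap.opNorm_le_bound _ (by positivity) fun x => ?_
  rw [lamMap_apply, Prod.norm_def]
  have hp := Real.pi_lt_four
  have hp0 := Real.pi_pos
  have ht : ∀ i, |t i| ≤ ‖t‖ := fun i => PiLp.norm_apply_le t i
  have hx : ∀ i, |x i| ≤ ‖x‖ := fun i => PiLp.norm_apply_le x i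
  have hm : ∀ i, |t i * x i| ≤ ‖t‖ * ‖x‖ := fun i => by
    rw [abs_mul]; exact mul_le_mul (ht i) (hx i) (abs_nonneg _) (norm_nonneg _)
  have n1 := norm_nonneg t
  have n2 := norm_nonneg x
  refine max_le ?_ ?_
  · have e : 2 * Real.pi * t 0 * x 0 + 2 * Real.pi * t 1 * x 1 =
      2 * Real.pi * (t 0 * x 0 + t 1 * x 1) := by ring
    simp only [Real.norm_eq_abs]
    rw [e, abs_mul, abs_of_pos (by positivity : 0 < 2 * Real.pi)]
    have h3 : |t 0 * x 0 + t 1 * x 1| ≤ 2 * (‖t‖ * ‖x‖) := by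
      have := abs_add_le (t 0 * x 0) (t 1 * x 1)
      linarith [hm 0, hm 1]
    calc _ ≤ 8 * (2 * (‖t‖ * ‖x‖)) := by gcongr; linarith
      _ ≤ _ := by nlinarith [mul_nonneg n1 n2, mul_nonneg (mul_nonneg n1 n1) n2]
  · simp only [Real.norm_eq_abs]
    rw [abs_mul, abs_of_nonneg (sq_nonneg _)]
    have h2 : t 2 ^ 2 ≤ ‖t‖ ^ 2 := by
      rw [← sq_abs]; gcongr; exact ht 2
    have h3 : (2 * Real.pi * t 2) ^ 2 ≤ 64 * ‖t‖ ^ 2 := by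
      rw [mul_pow]
      have : (2 * Real.pi) ^ 2 ≤ 64 := by nlinarith
      gcongr
    calc _ ≤ 64 * ‖t‖ ^ 2 * ‖x‖ := by gcongr; exact hx 2
      _ ≤ _ := by gcongr; linarith

open MeasureTheory FourierTransform SchwartzMap in
theorem fourier_even (f : V3 → ℂ) (hf : ContDiff ℝ (⊤ : ℕ∞) f) (hc : HasCompactSupport f) :
    ∃ g : V3 → ℂ, ContDiff ℝ (⊤ : ℕ∞) g ∧
      ∀ x y z : ℝ, (f !₂[x, y, z] + f !₂[x, y, -z]) / 2 = g !₂[x, y, z ^ 2] := by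
  obtain ⟨G, hG, hGc, hGb⟩ := exists_kernel
  let F : 𝓢(V3, ℂ) := hc.toSchwartzMap hf
  let B : 𝓢(V3, ℂ) := 𝓕 F
  have hB : ∀ x : V3, f x = ∫ t, Complex.exp ((2 * Real.pi * inner ℝ t x : ℝ) * Complex.I) * B t := by
    intro x
    have h1 : (𝓕⁻ B : 𝓢(V3, ℂ)) = F := FourierTransform.fourierInv_fourier_eq F
    have h2 : F x = f x := rfl
    rw [← h2, ← h1, SchwartzMap.fourierInv_coe, Real.fourierInv_eq']
    simp
  refine ⟨fun x => ∫ t, (fun z : V3 × V3 => B z.2 * G (lamMap z.2 z.1)) (x, t), ?_, ?_⟩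
  · refine contDiff_infty.2 fun n => contDiff_dominated_nat volume n
      (f := fun z : V3 × V3 => B z.2 * G (lamMap z.2 z.1)) ?_ ?_
    · refine ((B.smooth _).comp contDiff_snd).mul (hG.comp ?_)
      simp_rw [lamMap_apply]
      fun_prop
    · intro m
      obtain ⟨M, hM0, hM⟩ := hGb m
      refine ⟨fun t => M * 64 ^ m * 2 ^ (2 * m - 1) * (‖t‖ ^ 0 * ‖B t‖ + ‖t‖ ^ (2 * m) * ‖B t‖), ?_, ?_⟩
      · exact ((B.integrable_pow_mul volume 0).add (B.integrable_pow_mul volume (2 * m))).const_mul _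
      · intro t x
        have e : (fun x => B t * G (lamMap t x)) = fun x => B t • (G ∘ lamMap t) x := rfl
        simp only
        rw [e]
        rw [show (fun x => B t • (G ∘ lamMap t) x) = B t • (G ∘ lamMap t) from rfl]
        rw [iteratedFDeriv_const_smul_apply ((hG.comp (lamMap t).contDiff).of_le (by exact_mod_cast le_top)).contDiffAt,
          norm_smul, (lamMap t).iteratedFDeriv_comp_right hG x (by exact_mod_cast le_top)]
        have h1 := ContinuousMultilinearMap.norm_compContinuousLinearMap_le
          (iteratedFDeriv ℝ m G (lamMap t x)) (fun _ => lamMap t)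
        have h2 : ∏ _j : Fin m, ‖lamMap t‖ ≤ (64 * (1 + ‖t‖) ^ 2) ^ m := by
          rw [Finset.prod_const, Finset.card_univ, Fintype.card_fin]
          gcongr
          exact lamMap_norm t
        have h3 : (1 + ‖t‖) ^ (2 * m) ≤ 2 ^ (2 * m - 1) * (1 ^ (2 * m) + ‖t‖ ^ (2 * m)) :=
          add_pow_le zero_le_one (norm_nonneg _) _
        calc _ ≤ ‖B t‖ * (M * (64 * (1 + ‖t‖) ^ 2) ^ m) := by
              gcongr
              refine h1.trans ?_
              gcongr
              exact hM _
          _ = ‖B t‖ * M * 64 ^ m * (1 + ‖t‖) ^ (2 * m) := by rw [mul_pow, ← pow_mul]; ring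
          _ ≤ ‖B t‖ * M * 64 ^ m * (2 ^ (2 * m - 1) * (1 ^ (2 * m) + ‖t‖ ^ (2 * m))) := by gcongr
          _ = _ := by rw [one_pow, pow_zero]; ring
  · intro x y z
    have hi : ∀ x : V3, Integrable
        (fun t => Complex.exp ((2 * Real.pi * inner ℝ t x : ℝ) * Complex.I) * B t) := by
      intro x
      refine B.integrable.norm.mono' ?_ ?_
      · exact Continuous.aestronglyMeasurable (by have := B.continuous; fun_prop)
      · refine Filter.Eventually.of_forall fun t => ?_
        rw [norm_mul, Complex.norm_exp_ofReal_mul_I, one_mul]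
    rw [hB, hB, ← integral_add (hi _) (hi _), ← integral_div]
    refine integral_congr_ae (Filter.Eventually.of_forall fun t => ?_)
    simp only [lamMap_apply]
    have e : (2 * Real.pi * t 2) ^ 2 * (!₂[x, y, z ^ 2] : V3) 2 = (2 * Real.pi * t 2 * z) ^ 2 := by
      simp; ring
    rw [e, hGc, Complex.ofReal_cos, Complex.cos]
    have i1 : ∀ w : ℝ, inner ℝ t (!₂[x, y, w] : V3) = t 0 * x + t 1 * y + t 2 * w := by
      intro w
      simp [PiLp.inner_apply, Fin.sum_univ_three]
      ring
    rw [i1, i1]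
    have x1 : ∀ w : ℝ, Complex.exp ((2 * Real.pi * (t 0 * x + t 1 * y + t 2 * w) : ℝ) * Complex.I) =
      Complex.exp ((2 * Real.pi * t 0 * x + 2 * Real.pi * t 1 * y : ℝ) * Complex.I) *
        Complex.exp ((2 * Real.pi * t 2 * w : ℝ) * Complex.I) := by
      intro w
      rw [← Complex.exp_add]
      congr 1
      push_cast
      ring
    rw [x1, x1]
    have x2 : ((2 * Real.pi * t 2 * -z : ℝ) : ℂ) * Complex.I = -((2 * Real.pi * t 2 * z : ℝ) : ℂ) * Complex.I := by
      push_cast; ring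
    rw [x2]
    simp
    ring

theorem whitney_local {W : Set (ℝ × ℝ × ℝ)} (hW : IsOpen W) (A : ℝ × ℝ × ℝ → ℝ)
    (hA : ContDiffOn ℝ (⊤ : ℕ∞) A W) (heven : ∀ x y z, A (x, y, -z) = A (x, y, z))
    (x₀ y₀ : ℝ) (h0 : (x₀, y₀, (0 : ℝ)) ∈ W) :
    ∃ r > 0, ∃ g : ℝ × ℝ × ℝ → ℝ, ContDiff ℝ (⊤ : ℕ∞) g ∧
      ∀ x y z, |x - x₀| < r → |y - y₀| < r → |z| < r → g (x, y, z ^ 2) = A (x, y, z) := by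
  obtain ⟨δ, hδ, hball⟩ := Metric.isOpen_iff.1 hW _ h0
  let χ : ContDiffBump ((x₀, y₀, (0 : ℝ)) : ℝ × ℝ × ℝ) :=
    ⟨δ / 4, δ / 2, by positivity, by linarith⟩
  have hsupp : tsupport χ ⊆ W := by
    rw [χ.tsupport_eq]
    exact (Metric.closedBall_subset_ball (by change δ / 2 < δ; linarith)).trans hball
  have hprod : ContDiff ℝ (⊤ : ℕ∞) (fun z => χ z * A z) := by
    rw [contDiff_iff_contDiffAt]
    intro z
    by_cases hz : z ∈ W
    · exact χ.contDiff.contDiffAt.mul (hA.contDiffAt (hW.mem_nhds hz))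
    · have : z ∉ tsupport χ := fun h => hz (hsupp h)
      have h1 : (fun z => χ z * A z) =ᶠ[nhds z] fun _ => 0 := by
        filter_upwards [(isClosed_tsupport χ).isOpen_compl.mem_nhds this] with y hy
        rw [image_eq_zero_of_notMem_tsupport hy, zero_mul]
      exact contDiffAt_const.congr_of_eventuallyEq h1
  have hcs : HasCompactSupport (fun z => χ z * A z) := χ.hasCompactSupport.mul_right
  let e : V3 → ℝ × ℝ × ℝ := fun v => (v 0, v 1, v 2)
  have he : ContDiff ℝ (⊤ : ℕ∞) e := by fun_prop
  let e' : ℝ × ℝ × ℝ → V3 := fun z => !₂[z.1, z.2.1, z.2.2]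
  have he' : ContDiff ℝ (⊤ : ℕ∞) e' := by
    rw [contDiff_euclidean]
    intro i
    fin_cases i <;> simp [e'] <;> fun_prop
  let eh : V3 ≃ₜ ℝ × ℝ × ℝ :=
    { toFun := e, invFun := e'
      left_inv := fun v => by
        ext i; fin_cases i <;> simp [e, e']
      right_inv := fun z => by simp [e, e']
      continuous_toFun := he.continuous
      continuous_invFun := he'.continuous }
  have hcs' : HasCompactSupport (fun v : V3 => ((χ (e v) * A (e v) : ℝ) : ℂ)) := by
    have h1 := hcs.comp_homeomorph eh
    exact h1.comp_left (g := fun x : ℝ => (x : ℂ)) (by simp)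
  obtain ⟨g, hg, hgf⟩ := fourier_even (fun v : V3 => ((χ (e v) * A (e v) : ℝ) : ℂ))
    (Complex.ofRealCLM.contDiff.comp (hprod.comp he)) hcs'
  refine ⟨δ / 4, by positivity, fun z => (g (e' z)).re,
    Complex.reCLM.contDiff.comp (hg.comp he'), ?_⟩
  intro x y z hx hy hz
  have h1 : ∀ w, |w| < δ / 4 → χ (x, y, w) = 1 := by
    intro w hw
    refine χ.one_of_mem_closedBall ?_
    rw [Metric.mem_closedBall, Prod.dist_eq, Prod.dist_eq]
    simp only [Real.dist_eq, sub_zero]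
    exact max_le hx.le (max_le hy.le hw.le)
  have h2 := hgf x y z
  simp only [e, e'] at h2 ⊢
  rw [← h2]
  simp [h1 z hz, h1 (-z) (by rwa [abs_neg]), heven]

theorem whitney_param (a₂ b₂ ε : ℝ) (hε : 0 < ε) (A : ℝ × ℝ × ℝ → ℝ)
    (hA : ContDiffOn ℝ (⊤ : ℕ∞) A (univ ×ˢ (Ioo a₂ b₂ ×ˢ Ioo (-ε) ε)))
    (heven : ∀ x y z, A (x, y, -z) = A (x, y, z)) :
    ∃ ψ : ℝ × ℝ × ℝ → ℝ,
      ContDiffOn ℝ (⊤ : ℕ∞) ψ (univ ×ˢ (Ioo a₂ b₂ ×ˢ Ioo (-(ε ^ 2) / 2) (ε ^ 2 / 2))) ∧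
      ∀ x y, y ∈ Ioo a₂ b₂ → ∀ z, 0 ≤ z → z < ε → ψ (x, y, z ^ 2 / 2) = A (x, y, z) := by
  classical
  have hWo : IsOpen ((univ : Set ℝ) ×ˢ (Ioo a₂ b₂ ×ˢ Ioo (-ε) ε)) :=
    isOpen_univ.prod (isOpen_Ioo.prod isOpen_Ioo)
  have hUo : IsOpen ((univ : Set ℝ) ×ˢ (Ioo a₂ b₂ ×ˢ Ioo (-(ε ^ 2) / 2) (ε ^ 2 / 2))) :=
    isOpen_univ.prod (isOpen_Ioo.prod isOpen_Ioo)
  obtain ⟨ψ, hψ, hψt⟩ := exists_glue hUo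
    (fun z => if 0 ≤ z.2.2 then {A (z.1, z.2.1, √(2 * z.2.2))} else univ)
    (by
      intro z
      split_ifs
      · exact convex_singleton _
      · exact convex_univ)
    (by
      rintro ⟨x₀, y₀, z₀⟩ ⟨-, hy, hz⟩
      simp only at hy hz
      rcases lt_trichotomy z₀ 0 with h | h | h
      · refine ⟨{z | z.2.2 < 0}, ?_, fun _ => 0, contDiffOn_const, ?_⟩
        · exact (isOpen_lt (by fun_prop) continuous_const).mem_nhds h
        · intro z hz _
          have : ¬ (0 ≤ z.2.2) := not_le.2 hz
          simp [this]
      · subst h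
        obtain ⟨r, hr, g, hg, hgA⟩ := whitney_local hWo A hA heven x₀ y₀
          ⟨mem_univ _, hy, by simp [hε]⟩
        refine ⟨{z | |z.1 - x₀| < r ∧ |z.2.1 - y₀| < r ∧ 2 * z.2.2 < r ^ 2}, ?_,
          fun z => g (z.1, z.2.1, 2 * z.2.2), ?_, ?_⟩
        · refine IsOpen.mem_nhds ?_ ⟨by simpa, by simpa, by simpa using by positivity⟩
          have o1 : IsOpen {z : ℝ × ℝ × ℝ | |z.1 - x₀| < r} :=
            isOpen_lt (by fun_prop) continuous_const
          have o2 : IsOpen {z : ℝ × ℝ × ℝ | |z.2.1 - y₀| < r} :=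
            isOpen_lt (by fun_prop) continuous_const
          have o3 : IsOpen {z : ℝ × ℝ × ℝ | 2 * z.2.2 < r ^ 2} :=
            isOpen_lt (by fun_prop) continuous_const
          exact o1.inter (o2.inter o3)
        · exact (hg.comp (by fun_prop)).contDiffOn
        · rintro ⟨x, y, z⟩ ⟨h1, h2, h3⟩ _
          simp only at h1 h2 h3 ⊢
          split_ifs with hz
          · rw [mem_singleton_iff, ← hgA x y _ h1 h2, Real.sq_sqrt (by linarith)]
            rw [abs_of_nonneg (Real.sqrt_nonneg _), Real.sqrt_lt' hr]
            exact h3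
          · trivial
      · refine ⟨univ ×ˢ (Ioo a₂ b₂ ×ˢ Ioo 0 (ε ^ 2 / 2)), ?_,
          fun z => A (z.1, z.2.1, √(2 * z.2.2)), ?_, ?_⟩
        · exact (isOpen_univ.prod (isOpen_Ioo.prod isOpen_Ioo)).mem_nhds
            ⟨mem_univ _, hy, h, hz.2⟩
        · refine hA.comp ?_ ?_
          · have : ContDiffOn ℝ (⊤ : ℕ∞) (fun z : ℝ × ℝ × ℝ => √(2 * z.2.2))
                (univ ×ˢ (Ioo a₂ b₂ ×ˢ Ioo 0 (ε ^ 2 / 2))) := by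
              refine ContDiffOn.sqrt (by fun_prop) ?_
              rintro z ⟨-, -, h1, -⟩
              have : 0 < z.2.2 := h1
              positivity
            exact contDiffOn_fst.prodMk ((by fun_prop : ContDiff ℝ (⊤ : ℕ∞) (fun z : ℝ × ℝ × ℝ => z.2.1)).contDiffOn.prodMk this)
          · rintro z ⟨-, h1, h2, h3⟩
            refine ⟨mem_univ _, h1, ?_, ?_⟩
            · have := Real.sqrt_nonneg (2 * z.2.2)
              simp only; linarith
            · rw [Real.sqrt_lt' hε]; linarith
        · rintro z ⟨-, -, h1, -⟩ _
          have : 0 ≤ z.2.2 := h1.le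
          simp [this])
  refine ⟨ψ, hψ, fun x y hy z hz hzε => ?_⟩
  have := hψt (x, y, z ^ 2 / 2) ⟨mem_univ _, hy, by
    constructor
    · have := sq_nonneg z
      simp only; nlinarith
    · simp only; nlinarith⟩
  simp only at this
  rw [if_pos (by positivity), mem_singleton_iff] at this
  rw [this, show 2 * (z ^ 2 / 2) = z ^ 2 by ring, Real.sqrt_sq hz]


theorem pdx₁_eq {f : P4 → ℝ} {p : P4} (hf : DifferentiableAt ℝ f p) :
    pdx₁ f p = fderiv ℝ f p (1, 0, 0, 0) := by
  have h : HasDerivAt (fun t : ℝ => ((t, p.2.1, p.2.2.1, p.2.2.2) : P4)) (1, 0, 0, 0) p.1 :=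
    (hasDerivAt_id _).prodMk ((hasDerivAt_const _ _).prodMk
      ((hasDerivAt_const _ _).prodMk (hasDerivAt_const _ _)))
  exact (hf.hasFDerivAt.comp_hasDerivAt p.1 h).deriv

theorem pdx₂_eq {f : P4 → ℝ} {p : P4} (hf : DifferentiableAt ℝ f p) :
    pdx₂ f p = fderiv ℝ f p (0, 0, 1, 0) := by
  have h : HasDerivAt (fun t : ℝ => ((p.1, p.2.1, t, p.2.2.2) : P4)) (0, 0, 1, 0) p.2.2.1 :=
    (hasDerivAt_const _ _).prodMk ((hasDerivAt_const _ _).prodMk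
      ((hasDerivAt_id _).prodMk (hasDerivAt_const _ _)))
  exact (hf.hasFDerivAt.comp_hasDerivAt p.2.2.1 h).deriv

theorem pdxi₂_eq {f : P4 → ℝ} {p : P4} (hf : DifferentiableAt ℝ f p) :
    pdxi₂ f p = fderiv ℝ f p (0, 0, 0, 1) := by
  have h : HasDerivAt (fun t : ℝ => ((p.1, p.2.1, p.2.2.1, t) : P4)) (0, 0, 0, 1) p.2.2.2 :=
    (hasDerivAt_const _ _).prodMk ((hasDerivAt_const _ _).prodMk
      ((hasDerivAt_const _ _).prodMk (hasDerivAt_id _)))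
  exact (hf.hasFDerivAt.comp_hasDerivAt p.2.2.2 h).deriv

theorem poisson_xi_left (f : P4 → ℝ) (p : P4) : poisson xi₁fun f p = pdx₁ f p := by
  simp [poisson, pdx₁, pdxi₁, pdx₂, pdxi₂, xi₁fun]

theorem poisson_xi_right (f : P4 → ℝ) (p : P4) : poisson f xi₁fun p = - pdx₁ f p := by
  simp [poisson, pdx₁, pdxi₁, pdx₂, pdxi₂, xi₁fun]

theorem pdx₂_q (p : P4) : pdx₂ qfun p = p.2.2.1 := by
  have h : HasDerivAt (fun t : ℝ => (t ^ 2 + p.2.2.2 ^ 2) / 2) (p.2.2.1) p.2.2.1 := by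
    have := ((hasDerivAt_pow 2 p.2.2.1).add_const (p.2.2.2 ^ 2)).div_const 2
    refine this.congr_deriv ?_
    norm_num
  exact h.deriv

theorem pdxi₂_q (p : P4) : pdxi₂ qfun p = p.2.2.2 := by
  have h : HasDerivAt (fun t : ℝ => (p.2.2.1 ^ 2 + t ^ 2) / 2) (p.2.2.2) p.2.2.2 := by
    have := ((hasDerivAt_pow 2 p.2.2.2).const_add (p.2.2.1 ^ 2)).div_const 2
    refine this.congr_deriv ?_
    norm_num
  exact h.deriv

theorem poisson_q_left (f : P4 → ℝ) (p : P4) :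
    poisson qfun f p = p.2.2.2 * pdx₂ f p - p.2.2.1 * pdxi₂ f p := by
  have h1 : pdx₁ qfun p = 0 := by simp [pdx₁, qfun]
  have h2 : pdxi₁ qfun p = 0 := by simp [pdxi₁, qfun]
  rw [poisson, pdx₂_q, pdxi₂_q, h1, h2]
  ring

theorem poisson_q_right (f : P4 → ℝ) (p : P4) : poisson f qfun p = - poisson qfun f p := by
  unfold poisson; ring

/-- the flow of `q` -/
noncomputable def rotv (t : ℝ) (v : ℝ × ℝ) : ℝ × ℝ :=
  (v.1 * Real.cos t + v.2 * Real.sin t, - v.1 * Real.sin t + v.2 * Real.cos t)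

theorem rotv_zero (v : ℝ × ℝ) : rotv 0 v = v := by simp [rotv]

theorem rotv_rotv (s t : ℝ) (v : ℝ × ℝ) : rotv s (rotv t v) = rotv (s + t) v := by
  simp only [rotv, Real.cos_add, Real.sin_add]
  ext <;> simp <;> ring

theorem rotv_periodic (t : ℝ) (v : ℝ × ℝ) : rotv (t + 2 * Real.pi) v = rotv t v := by
  simp [rotv]

theorem rotv_norm (t : ℝ) (v : ℝ × ℝ) :
    (rotv t v).1 ^ 2 + (rotv t v).2 ^ 2 = v.1 ^ 2 + v.2 ^ 2 := by
  simp only [rotv]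
  linear_combination (v.1 ^ 2 + v.2 ^ 2) * Real.sin_sq_add_cos_sq t

theorem rotv_contDiff : ContDiff ℝ (⊤ : ℕ∞) (fun z : ℝ × (ℝ × ℝ) => rotv z.1 z.2) := by
  unfold rotv
  have h1 : ContDiff ℝ (⊤ : ℕ∞) (fun z : ℝ × (ℝ × ℝ) => Real.cos z.1) :=
    Real.contDiff_cos.comp contDiff_fst
  have h2 : ContDiff ℝ (⊤ : ℕ∞) (fun z : ℝ × (ℝ × ℝ) => Real.sin z.1) :=
    Real.contDiff_sin.comp contDiff_fst
  fun_prop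

theorem exists_rotv (v : ℝ × ℝ) : ∃ θ, v = rotv θ (√(v.1 ^ 2 + v.2 ^ 2), 0) := by
  refine ⟨- Complex.arg ⟨v.1, v.2⟩, ?_⟩
  have hn : ‖(⟨v.1, v.2⟩ : ℂ)‖ = √(v.1 ^ 2 + v.2 ^ 2) := by
    rw [Complex.norm_def, Complex.normSq_apply]; congr 1; ring
  have h1 := Complex.norm_mul_cos_arg ⟨v.1, v.2⟩
  have h2 := Complex.norm_mul_sin_arg ⟨v.1, v.2⟩
  rw [hn] at h1 h2
  simp only at h1 h2
  ext
  · simp [rotv, h1]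
  · simp [rotv, h2]

theorem poisson_q_eq_deriv {f : P4 → ℝ} {p : P4} (hf : DifferentiableAt ℝ f p) :
    HasDerivAt (fun t : ℝ => f (p.1, p.2.1, rotv t p.2.2)) (poisson qfun f p) 0 := by
  have hr : HasDerivAt (fun t : ℝ => rotv t p.2.2) (p.2.2.2, - p.2.2.1) 0 := by
    unfold rotv
    have c := Real.hasDerivAt_cos 0
    have s := Real.hasDerivAt_sin 0
    refine ((c.const_mul p.2.2.1).add (s.const_mul p.2.2.2)).prodMk
      ((s.const_mul (-p.2.2.1)).add (c.const_mul p.2.2.2)) |>.congr_deriv ?_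
    simp
  have h : HasDerivAt (fun t : ℝ => ((p.1, p.2.1, rotv t p.2.2) : P4))
      (0, 0, p.2.2.2, - p.2.2.1) 0 :=
    (hasDerivAt_const _ _).prodMk ((hasDerivAt_const _ _).prodMk hr)
  have hp : ((p.1, p.2.1, rotv 0 p.2.2) : P4) = p := by rw [rotv_zero]
  have h' := HasFDerivAt.comp_hasDerivAt (x := (0 : ℝ)) (f := fun t : ℝ => ((p.1, p.2.1, rotv t p.2.2) : P4))
    (l := f) (l' := fderiv ℝ f p) (by rw [hp]; exact hf.hasFDerivAt) h
  refine h'.congr_deriv ?_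
  rw [poisson_q_left, pdx₂_eq hf, pdxi₂_eq hf]
  have : ((0, 0, p.2.2.2, - p.2.2.1) : P4) =
      p.2.2.2 • ((0, 0, 1, 0) : P4) - p.2.2.1 • ((0, 0, 0, 1) : P4) := by
    simp
  rw [this, map_sub, map_smul, map_smul]
  rfl

theorem deriv_weighted {H : ℝ → ℝ} (hH : Continuous H) (hp : ∀ t, H (t + 2 * Real.pi) = H t) :
    HasDerivAt (fun τ => ∫ t in (0 : ℝ)..(2 * Real.pi), t * H (t + τ))
      (2 * Real.pi * H 0 - ∫ t in (0 : ℝ)..(2 * Real.pi), H t) 0 := by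
  have hKc : Continuous fun t => t * H t := continuous_id.mul hH
  have hK : ∀ x, HasDerivAt (fun x => ∫ t in (0 : ℝ)..x, t * H t) (x * H x) x := fun x =>
    intervalIntegral.integral_hasDerivAt_right (hKc.intervalIntegrable _ _)
      hKc.stronglyMeasurable.stronglyMeasurableAtFilter hKc.continuousAt
  have e : (fun τ => ∫ t in (0 : ℝ)..(2 * Real.pi), t * H (t + τ)) = fun τ =>
      (∫ t in (0 : ℝ)..(2 * Real.pi + τ), t * H t) - (∫ t in (0 : ℝ)..τ, t * H t)
        - τ * ∫ t in (0 : ℝ)..(2 * Real.pi), H t := by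
    ext τ
    have h1 := intervalIntegral.integral_comp_add_right (a := 0) (b := 2 * Real.pi)
      (fun t => (t - τ) * H t) τ
    simp only [add_sub_cancel_right, zero_add] at h1
    rw [h1]
    have h2 : ∫ t in τ..(2 * Real.pi + τ), (t - τ) * H t =
        (∫ t in τ..(2 * Real.pi + τ), t * H t) - τ * ∫ t in τ..(2 * Real.pi + τ), H t := by
      rw [← intervalIntegral.integral_const_mul, ← intervalIntegral.integral_sub
        (hKc.intervalIntegrable _ _) ((hH.const_mul τ).intervalIntegrable _ _)]
      simp_rw [sub_mul]
    have h3 : ∫ t in τ..(2 * Real.pi + τ), H t = ∫ t in (0 : ℝ)..(2 * Real.pi), H t := by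
      have := Function.Periodic.intervalIntegral_add_eq (f := H) (T := 2 * Real.pi) hp τ 0
      rw [zero_add, add_comm] at this
      exact this
    rw [h2, h3, ← intervalIntegral.integral_interval_sub_left
      (hKc.intervalIntegrable _ _) (hKc.intervalIntegrable _ _)]
  rw [e]
  have h1 : HasDerivAt (fun τ : ℝ => 2 * Real.pi + τ) 1 0 := (hasDerivAt_id 0).const_add _
  have h2 := (((hK (2 * Real.pi + 0)).comp (0 : ℝ) h1).sub (hK 0)).sub
    ((hasDerivAt_id (0 : ℝ)).mul_const (∫ t in (0 : ℝ)..(2 * Real.pi), H t))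
  refine h2.congr_deriv ?_
  have := hp 0
  simp at this
  simp [this]

theorem integral_rot {h : ℝ × ℝ → ℝ} (θ : ℝ) (w : ℝ × ℝ) :
    ∫ t in (0 : ℝ)..(2 * Real.pi), h (rotv t (rotv θ w)) =
      ∫ t in (0 : ℝ)..(2 * Real.pi), h (rotv t w) := by
  simp_rw [rotv_rotv]
  rw [intervalIntegral.integral_comp_add_right (fun t => h (rotv t w)) θ]
  have hp : Function.Periodic (fun t => h (rotv t w)) (2 * Real.pi) := fun t => by
    simp only [rotv_periodic]
  have := hp.intervalIntegral_add_eq (0 + θ) 0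
  simp only [zero_add] at this ⊢
  rw [add_comm (2 * Real.pi) θ]
  exact this

/-- the domain -/
def Dom (a₁ b₁ a₂ b₂ ε : ℝ) : Set P4 :=
  (Set.Ioo a₁ b₁) ×ˢ ((Set.Ioo a₂ b₂) ×ˢ {v : ℝ × ℝ | v.1 ^ 2 + v.2 ^ 2 < ε ^ 2})

theorem isOpen_Dom (a₁ b₁ a₂ b₂ ε : ℝ) : IsOpen (Dom a₁ b₁ a₂ b₂ ε) := by
  refine isOpen_Ioo.prod (isOpen_Ioo.prod ?_)
  exact isOpen_lt (by fun_prop) (by fun_prop)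

/-- the solution of the equations -/
def nuSol (x0 : ℝ) (R S : ℝ → P4 → ℝ) (E : ℝ) (p : P4) : ℝ :=
  -((p.1 - x0) * ∫ u in (0 : ℝ)..1, R E (x0 + (p.1 - x0) * u, p.2.1, p.2.2)) -
    (1 / (2 * Real.pi)) * ∫ t in (0 : ℝ)..(2 * Real.pi), t * S E (x0, p.2.1, rotv t p.2.2)

theorem nuSol_eq (x0 : ℝ) (R S : ℝ → P4 → ℝ) (E : ℝ) (p : P4) :
    nuSol x0 R S E p = -(∫ t in x0..p.1, R E (t, p.2)) -
    (1 / (2 * Real.pi)) * ∫ t in (0 : ℝ)..(2 * Real.pi), t * S E (x0, p.2.1, rotv t p.2.2) := by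
  unfold nuSol
  have := intervalIntegral.mul_integral_comp_add_mul (a := 0) (b := 1)
    (f := fun t => R E (t, p.2)) (p.1 - x0) x0
  simp only [mul_zero, add_zero, mul_one, add_sub_cancel] at this
  rw [← this]

theorem segm {a b x y t : ℝ} (hx : x ∈ Ioo a b) (hy : y ∈ Ioo a b) (ht : t ∈ Icc (0 : ℝ) 1) :
    x + (y - x) * t ∈ Ioo a b := by
  have := (convex_Ioo a b).add_smul_sub_mem hx hy ht
  simpa [mul_comm] using this

theorem nuSol_contDiffOn {a₁ b₁ a₂ b₂ ε x0 : ℝ} (hx0 : x0 ∈ Ioo a₁ b₁) {R S : ℝ → P4 → ℝ}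
    (hR : ContDiffOn ℝ (⊤ : ℕ∞) (fun z : ℝ × P4 => R z.1 z.2) (univ ×ˢ Dom a₁ b₁ a₂ b₂ ε))
    (hS : ContDiffOn ℝ (⊤ : ℕ∞) (fun z : ℝ × P4 => S z.1 z.2) (univ ×ˢ Dom a₁ b₁ a₂ b₂ ε)) :
    ContDiffOn ℝ (⊤ : ℕ∞) (fun z : ℝ × P4 => nuSol x0 R S z.1 z.2)
      (univ ×ˢ Dom a₁ b₁ a₂ b₂ ε) := by
  have hO : IsOpen ((univ : Set ℝ) ×ˢ Dom a₁ b₁ a₂ b₂ ε) := isOpen_univ.prod (isOpen_Dom ..)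
  unfold nuSol
  have h1 : ContDiffOn ℝ (⊤ : ℕ∞) (fun z : ℝ × P4 => ∫ u in (0 : ℝ)..1,
      R z.1 (x0 + (z.2.1 - x0) * u, z.2.2.1, z.2.2.2)) (univ ×ˢ Dom a₁ b₁ a₂ b₂ ε) := by
    let m : (ℝ × P4) × ℝ → ℝ × P4 := fun y =>
      (y.1.1, (x0 + (y.1.2.1 - x0) * y.2, y.1.2.2.1, y.1.2.2.2))
    have hm : ContDiff ℝ (⊤ : ℕ∞) m := by fun_prop
    refine contDiffOn_param (W := m ⁻¹' (univ ×ˢ Dom a₁ b₁ a₂ b₂ ε))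
      (f := fun y => R (m y).1 (m y).2) (hO.preimage hm.continuous) hO ?_ ?_
    · rintro ⟨E, x, y, v⟩ ⟨-, hx, hy, hv⟩ t ht
      rw [uIcc_of_le zero_le_one] at ht
      exact ⟨trivial, segm hx0 hx ht, hy, hv⟩
    · exact hR.comp hm.contDiffOn (fun _ h => h)
  have h2 : ContDiffOn ℝ (⊤ : ℕ∞) (fun z : ℝ × P4 => ∫ t in (0 : ℝ)..(2 * Real.pi),
      t * S z.1 (x0, z.2.2.1, rotv t z.2.2.2)) (univ ×ˢ Dom a₁ b₁ a₂ b₂ ε) := by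
    let m : (ℝ × P4) × ℝ → ℝ × P4 := fun y =>
      (y.1.1, (x0, y.1.2.2.1, rotv y.2 y.1.2.2.2))
    have hm : ContDiff ℝ (⊤ : ℕ∞) m := by
      have : ContDiff ℝ (⊤ : ℕ∞) (fun y : (ℝ × P4) × ℝ => rotv y.2 y.1.2.2.2) :=
        rotv_contDiff.comp (f := fun y : (ℝ × P4) × ℝ => (y.2, y.1.2.2.2)) (by fun_prop)
      fun_prop
    refine contDiffOn_param (W := m ⁻¹' (univ ×ˢ Dom a₁ b₁ a₂ b₂ ε))
      (f := fun y => y.2 * S (m y).1 (m y).2) (hO.preimage hm.continuous) hO ?_ ?_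
    · rintro ⟨E, x, y, v⟩ ⟨-, hx, hy, hv⟩ t ht
      refine ⟨trivial, hx0, hy, ?_⟩
      exact (rotv_norm _ _).trans_lt hv
    · exact contDiff_snd.contDiffOn.mul (hS.comp hm.contDiffOn (fun _ h => h))
  have h3 : ContDiffOn ℝ (⊤ : ℕ∞) (fun z : ℝ × P4 => z.2.1 - x0) (univ ×ˢ Dom a₁ b₁ a₂ b₂ ε) :=
    ContDiff.contDiffOn (by fun_prop)
  exact (h3.mul h1).neg.sub (contDiffOn_const.mul h2)

theorem nuSol_pdx {a₁ b₁ a₂ b₂ ε x0 : ℝ} (hx0 : x0 ∈ Ioo a₁ b₁) {R S : ℝ → P4 → ℝ} {E : ℝ}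
    (hR : ContDiffOn ℝ (⊤ : ℕ∞) (R E) (Dom a₁ b₁ a₂ b₂ ε))
    {p : P4} (hp : p ∈ Dom a₁ b₁ a₂ b₂ ε) :
    poisson xi₁fun (nuSol x0 R S E) p = - R E p := by
  rw [poisson_xi_left]
  have hc : ContinuousOn (fun t => R E (t, p.2)) (Ioo a₁ b₁) :=
    hR.continuousOn.comp (f := fun t : ℝ => ((t, p.2) : P4)) (by fun_prop)
      (fun t ht => ⟨ht, hp.2⟩)
  have hsub : uIcc x0 p.1 ⊆ Ioo a₁ b₁ := by
    exact (ordConnected_Ioo).uIcc_subset hx0 hp.1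
  have h : HasDerivAt (fun x => ∫ t in x0..x, R E (t, p.2)) (R E (p.1, p.2)) p.1 :=
    intervalIntegral.integral_hasDerivAt_right ((hc.mono hsub).intervalIntegrable)
      (hc.stronglyMeasurableAtFilter isOpen_Ioo _ hp.1)
      (hc.continuousAt (isOpen_Ioo.mem_nhds hp.1))
  have h' := h.neg.sub_const ((1 / (2 * Real.pi)) *
    ∫ t in (0 : ℝ)..(2 * Real.pi), t * S E (x0, p.2.1, rotv t p.2.2))
  unfold pdx₁
  simp only [nuSol_eq]
  exact h'.deriv

theorem nuSol_term1 {a₁ b₁ a₂ b₂ ε x0 : ℝ} (hx0 : x0 ∈ Ioo a₁ b₁) {R S : P4 → ℝ}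
    (hR : ContDiffOn ℝ (⊤ : ℕ∞) R (Dom a₁ b₁ a₂ b₂ ε))
    (hS : ContDiffOn ℝ (⊤ : ℕ∞) S (Dom a₁ b₁ a₂ b₂ ε))
    (hb : ∀ p ∈ Dom a₁ b₁ a₂ b₂ ε, poisson S xi₁fun p = poisson R qfun p)
    {p : P4} (hp : p ∈ Dom a₁ b₁ a₂ b₂ ε) :
    HasDerivAt (fun τ => ∫ t in x0..p.1, R (t, p.2.1, rotv τ p.2.2))
      (S p - S (x0, p.2)) 0 := by
  have hO := isOpen_Dom a₁ b₁ a₂ b₂ ε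
  have hsub : uIcc x0 p.1 ⊆ Ioo a₁ b₁ := (ordConnected_Ioo).uIcc_subset hx0 hp.1
  let m : ℝ × ℝ → P4 := fun z => (z.2, p.2.1, rotv z.1 p.2.2)
  have hm : ContDiff ℝ (⊤ : ℕ∞) m := by
    have : ContDiff ℝ (⊤ : ℕ∞) (fun z : ℝ × ℝ => rotv z.1 p.2.2) :=
      rotv_contDiff.comp (f := fun z : ℝ × ℝ => (z.1, p.2.2)) (by fun_prop)
    fun_prop
  have hmem : ∀ t ∈ Ioo a₁ b₁, ∀ τ, m (τ, t) ∈ Dom a₁ b₁ a₂ b₂ ε := by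
    intro t ht τ
    refine ⟨ht, hp.2.1, ?_⟩
    exact (rotv_norm _ _).trans_lt hp.2.2
  have hf : ContDiffOn ℝ (⊤ : ℕ∞) (fun z => R (m z)) (m ⁻¹' Dom a₁ b₁ a₂ b₂ ε) :=
    hR.comp hm.contDiffOn (fun _ h => h)
  have hW := hO.preimage hm.continuous
  have key := hasFDerivAt_param_aux (a := x0) (b := p.1) (x₀ := (0 : ℝ)) hW
    (f := fun z => R (m z)) (hf.of_le (by exact_mod_cast le_top))
    (fun t ht => hmem t (hsub ht) 0)
  have hdS : ∀ t ∈ Ioo a₁ b₁, HasDerivAt (fun t => S (t, p.2)) (pdx₁ S (t, p.2)) t := by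
    intro t ht
    have hd : DifferentiableAt ℝ S (t, p.2) :=
      (hS.differentiableOn (by simp)).differentiableAt (hO.mem_nhds ⟨ht, hp.2⟩)
    have : DifferentiableAt ℝ (fun t => S (t, p.2)) t :=
      hd.comp t (f := fun t : ℝ => ((t, p.2) : P4)) (by fun_prop)
    exact this.hasDerivAt
  have hcS : ContinuousOn (fun t => pdx₁ S (t, p.2)) (Ioo a₁ b₁) := by
    have h1 : ContinuousOn (fderiv ℝ S) (Dom a₁ b₁ a₂ b₂ ε) :=
      hS.continuousOn_fderiv_of_isOpen hO (by simp)
    have h2 : ContinuousOn (fun t => fderiv ℝ S (t, p.2) (1, 0, 0, 0)) (Ioo a₁ b₁) :=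
      (h1.comp (f := fun t : ℝ => ((t, p.2) : P4)) (by fun_prop)
        (fun t ht => ⟨ht, hp.2⟩)).clm_apply continuousOn_const
    refine h2.congr fun t ht => pdx₁_eq ?_
    exact (hS.differentiableOn (by simp)).differentiableAt (hO.mem_nhds ⟨ht, hp.2⟩)
  have hder : ∀ t ∈ uIcc x0 p.1, (fderiv ℝ (fun z => R (m z)) (0, t)).comp
      (ContinuousLinearMap.inl ℝ ℝ ℝ) = pdx₁ S (t, p.2) • ContinuousLinearMap.id ℝ ℝ := by
    intro t ht
    have hq : ((t, p.2) : P4) ∈ Dom a₁ b₁ a₂ b₂ ε := ⟨hsub ht, hp.2⟩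
    have hd : DifferentiableAt ℝ R (t, p.2) :=
      (hR.differentiableOn (by simp)).differentiableAt (hO.mem_nhds hq)
    have e1 := poisson_q_eq_deriv hd
    have hb' := hb _ hq
    rw [poisson_xi_right, poisson_q_right, neg_inj] at hb'
    rw [← hb'] at e1
    have hd2 : DifferentiableAt ℝ (fun z => R (m z)) (0, t) :=
      (hf.differentiableOn (by simp)).differentiableAt (hW.mem_nhds (hmem t (hsub ht) 0))
    have hl : HasDerivAt (fun τ : ℝ => ((τ, t) : ℝ × ℝ)) (1, 0) 0 :=
      (hasDerivAt_id _).prodMk (hasDerivAt_const _ _)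
    have e2 := hd2.hasFDerivAt.comp_hasDerivAt (0 : ℝ) hl
    have e3 := e2.unique e1
    ext
    simpa using e3
  rw [intervalIntegral.integral_congr hder, intervalIntegral.integral_smul_const,
    intervalIntegral.integral_eq_sub_of_hasDerivAt (fun t ht => hdS t (hsub ht))
      (hcS.mono hsub).intervalIntegrable] at key
  have := key.hasDerivAt
  simpa [m] using this

theorem nuSol_q {a₁ b₁ a₂ b₂ ε x0 : ℝ} (hx0 : x0 ∈ Ioo a₁ b₁) {R S : ℝ → P4 → ℝ} {E : ℝ}
    (hR : ContDiffOn ℝ (⊤ : ℕ∞) (R E) (Dom a₁ b₁ a₂ b₂ ε))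
    (hS : ContDiffOn ℝ (⊤ : ℕ∞) (S E) (Dom a₁ b₁ a₂ b₂ ε))
    (hν : ContDiffOn ℝ (⊤ : ℕ∞) (nuSol x0 R S E) (Dom a₁ b₁ a₂ b₂ ε))
    (hb : ∀ p ∈ Dom a₁ b₁ a₂ b₂ ε, poisson (S E) xi₁fun p = poisson (R E) qfun p)
    {p : P4} (hp : p ∈ Dom a₁ b₁ a₂ b₂ ε) :
    poisson qfun (nuSol x0 R S E) p = - S E p +
      (1 / (2 * Real.pi)) * ∫ t in (0 : ℝ)..(2 * Real.pi), S E (x0, p.2.1, rotv t p.2.2) := by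
  have hO := isOpen_Dom a₁ b₁ a₂ b₂ ε
  have h1 := poisson_q_eq_deriv
    ((hν.differentiableOn (by simp)).differentiableAt (hO.mem_nhds hp))
  have h2 := nuSol_term1 hx0 hR hS hb hp
  have hr : Continuous fun t : ℝ => rotv t p.2.2 :=
    rotv_contDiff.continuous.comp (f := fun t : ℝ => (t, p.2.2)) (by fun_prop)
  have hH : Continuous fun t => S E (x0, p.2.1, rotv t p.2.2) := by
    refine hS.continuousOn.comp_continuous (f := fun t : ℝ => ((x0, p.2.1, rotv t p.2.2) : P4))
      (by fun_prop) fun t => ⟨hx0, hp.2.1, ?_⟩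
    exact (rotv_norm _ _).trans_lt hp.2.2
  have h3 := deriv_weighted hH (fun t => by simp only [rotv_periodic])
  have h4 := h2.neg.sub (h3.const_mul (1 / (2 * Real.pi)))
  have e : (fun t => nuSol x0 R S E (p.1, p.2.1, rotv t p.2.2)) =
      (-fun τ => ∫ t in x0..p.1, R E (t, p.2.1, rotv τ p.2.2)) - fun τ =>
        1 / (2 * Real.pi) * ∫ t in (0 : ℝ)..(2 * Real.pi),
          t * S E (x0, p.2.1, rotv (t + τ) p.2.2) := by
    ext τ
    simp only [nuSol_eq, rotv_rotv, Pi.sub_apply, Pi.neg_apply]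
  rw [e] at h1
  rw [h1.unique h4]
  rw [rotv_zero]
  have hpi := Real.pi_ne_zero
  field_simp
  ring

theorem core_param (a₁ b₁ a₂ b₂ ε : ℝ) (hε : 0 < ε) (R S : ℝ → P4 → ℝ)
    (hR : ContDiffOn ℝ (⊤ : ℕ∞) (fun z : ℝ × P4 => R z.1 z.2) (univ ×ˢ Dom a₁ b₁ a₂ b₂ ε))
    (hS : ContDiffOn ℝ (⊤ : ℕ∞) (fun z : ℝ × P4 => S z.1 z.2) (univ ×ˢ Dom a₁ b₁ a₂ b₂ ε))
    (hb : ∀ E : ℝ, ∀ p ∈ Dom a₁ b₁ a₂ b₂ ε, poisson (S E) xi₁fun p = poisson (R E) qfun p) :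
    ∃ (ν : ℝ → P4 → ℝ) (ψ : ℝ → ℝ × ℝ → ℝ),
      ContDiffOn ℝ (⊤ : ℕ∞) (fun z : ℝ × P4 => ν z.1 z.2) (univ ×ˢ Dom a₁ b₁ a₂ b₂ ε) ∧
      ContDiffOn ℝ (⊤ : ℕ∞) (fun z : ℝ × (ℝ × ℝ) => ψ z.1 z.2)
        (univ ×ˢ ((Ioo a₂ b₂) ×ˢ Ioo (-(ε ^ 2) / 2) (ε ^ 2 / 2))) ∧
      (∀ E : ℝ, ∀ p ∈ Dom a₁ b₁ a₂ b₂ ε, poisson xi₁fun (ν E) p + R E p = 0) ∧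
      (∀ E : ℝ, ∀ p ∈ Dom a₁ b₁ a₂ b₂ ε,
        poisson qfun (ν E) p + S E p + ψ E (p.2.1, qfun p) = 0) := by
  rcases (Ioo a₁ b₁).eq_empty_or_nonempty with hemp | ⟨x0, hx0⟩
  · have hD : Dom a₁ b₁ a₂ b₂ ε = ∅ := by
      unfold Dom
      rw [hemp, empty_prod]
    refine ⟨fun _ _ => 0, fun _ _ => 0, contDiffOn_const, contDiffOn_const, ?_, ?_⟩ <;>
    · intro E p hp
      rw [hD] at hp
      exact hp.elim
  have hO : IsOpen ((univ : Set ℝ) ×ˢ Dom a₁ b₁ a₂ b₂ ε) := isOpen_univ.prod (isOpen_Dom ..)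
  have slice : ∀ {T : ℝ → P4 → ℝ},
      ContDiffOn ℝ (⊤ : ℕ∞) (fun z : ℝ × P4 => T z.1 z.2) (univ ×ˢ Dom a₁ b₁ a₂ b₂ ε) →
      ∀ E, ContDiffOn ℝ (⊤ : ℕ∞) (T E) (Dom a₁ b₁ a₂ b₂ ε) := by
    intro T hT E
    exact hT.comp (f := fun p : P4 => (E, p)) (ContDiff.contDiffOn (by fun_prop))
      (fun p hp => ⟨trivial, hp⟩)
  let A : ℝ × ℝ × ℝ → ℝ := fun z =>
    -(1 / (2 * Real.pi)) * ∫ t in (0 : ℝ)..(2 * Real.pi), S z.1 (x0, z.2.1, rotv t (z.2.2, 0))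
  have hA : ContDiffOn ℝ (⊤ : ℕ∞) A (univ ×ˢ (Ioo a₂ b₂ ×ˢ Ioo (-ε) ε)) := by
    let m : (ℝ × ℝ × ℝ) × ℝ → ℝ × P4 := fun y => (y.1.1, (x0, y.1.2.1, rotv y.2 (y.1.2.2, 0)))
    have hm : ContDiff ℝ (⊤ : ℕ∞) m := by
      have : ContDiff ℝ (⊤ : ℕ∞) (fun y : (ℝ × ℝ × ℝ) × ℝ => rotv y.2 (y.1.2.2, 0)) :=
        rotv_contDiff.comp (f := fun y : (ℝ × ℝ × ℝ) × ℝ => (y.2, (y.1.2.2, (0 : ℝ))))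
          (by fun_prop)
      fun_prop
    refine contDiffOn_const.mul (contDiffOn_param (W := m ⁻¹' (univ ×ˢ Dom a₁ b₁ a₂ b₂ ε))
      (f := fun y => S (m y).1 (m y).2) (hO.preimage hm.continuous)
      (isOpen_univ.prod (isOpen_Ioo.prod isOpen_Ioo)) ?_ ?_)
    · rintro ⟨E, y, ρ⟩ ⟨-, hy, hρ⟩ t ht
      refine ⟨trivial, hx0, hy, (rotv_norm _ _).trans_lt ?_⟩
      have h1 : -ε < ρ := hρ.1
      have h2 : ρ < ε := hρ.2
      change ρ ^ 2 + 0 ^ 2 < ε ^ 2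
      nlinarith
    · exact hS.comp hm.contDiffOn (fun _ h => h)
  have heven : ∀ x y z, A (x, y, -z) = A (x, y, z) := by
    intro x y z
    have h := integral_rot (h := fun v => S x (x0, y, v)) Real.pi (z, 0)
    have e : rotv Real.pi (z, 0) = (-z, 0) := by simp [rotv]
    rw [e] at h
    simp only [A, h]
  obtain ⟨ψ, hψ, hψA⟩ := whitney_param a₂ b₂ ε hε A hA heven
  have hν := nuSol_contDiffOn hx0 hR hS
  refine ⟨nuSol x0 R S, fun E w => ψ (E, w), hν, hψ, ?_, ?_⟩
  · intro E p hp
    rw [nuSol_pdx hx0 (slice hR E) hp]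
    ring
  · intro E p hp
    rw [nuSol_q hx0 (slice hR E) (slice hS E) (slice hν E) (hb E) hp]
    have hv : p.2.2.1 ^ 2 + p.2.2.2 ^ 2 < ε ^ 2 := hp.2.2
    have hnn : 0 ≤ p.2.2.1 ^ 2 + p.2.2.2 ^ 2 := by positivity
    have e1 : qfun p = √(p.2.2.1 ^ 2 + p.2.2.2 ^ 2) ^ 2 / 2 := by
      rw [Real.sq_sqrt hnn]
      rfl
    have e2 := hψA E p.2.1 hp.2.1 (√(p.2.2.1 ^ 2 + p.2.2.2 ^ 2)) (Real.sqrt_nonneg _)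
      ((Real.sqrt_lt' hε).2 hv)
    obtain ⟨θ, hθ⟩ := exists_rotv p.2.2
    have e3 := integral_rot (h := fun v => S E (x0, p.2.1, v)) θ
      (√(p.2.2.1 ^ 2 + p.2.2.2 ^ 2), 0)
    rw [← hθ] at e3
    beta_reduce
    rw [e1, e2, e3]
    simp only [A]
    ring

/-- Solution of the local cohomological equations on
`Ω = V_{x₁} × V_{ξ₁} × B(0, ε)`, together with smooth dependence on a parameter. -/
theorem local_cohomological_equations
    (a₁ b₁ a₂ b₂ ε : ℝ) (hε : 0 < ε)
    (Ω : Set P4)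
    (hΩ : Ω = (Set.Ioo a₁ b₁) ×ˢ ((Set.Ioo a₂ b₂) ×ˢ
      {v : ℝ × ℝ | v.1 ^ 2 + v.2 ^ 2 < ε ^ 2}))
    (r s : P4 → ℝ)
    (hr : ContDiffOn ℝ (⊤ : ℕ∞) r Ω) (hs : ContDiffOn ℝ (⊤ : ℕ∞) s Ω)
    (hbracket : ∀ p ∈ Ω, poisson s xi₁fun p = poisson r qfun p) :
    (∃ (ν : P4 → ℝ) (ψ : ℝ × ℝ → ℝ),
      ContDiffOn ℝ (⊤ : ℕ∞) ν Ω ∧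
      ContDiffOn ℝ (⊤ : ℕ∞) ψ ((Set.Ioo a₂ b₂) ×ˢ Set.Ioo (-(ε ^ 2) / 2) (ε ^ 2 / 2)) ∧
      (∀ p ∈ Ω, poisson xi₁fun ν p + r p = 0) ∧
      (∀ p ∈ Ω, poisson qfun ν p + s p + ψ (p.2.1, qfun p) = 0)) ∧
    -- smooth dependence on an additional parameter `E`
    (∀ R S : ℝ → P4 → ℝ,
      ContDiffOn ℝ (⊤ : ℕ∞) (fun z : ℝ × P4 => R z.1 z.2) (Set.univ ×ˢ Ω) →
      ContDiffOn ℝ (⊤ : ℕ∞) (fun z : ℝ × P4 => S z.1 z.2) (Set.univ ×ˢ Ω) →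
      (∀ E : ℝ, ∀ p ∈ Ω, poisson (S E) xi₁fun p = poisson (R E) qfun p) →
      ∃ (ν : ℝ → P4 → ℝ) (ψ : ℝ → ℝ × ℝ → ℝ),
        ContDiffOn ℝ (⊤ : ℕ∞) (fun z : ℝ × P4 => ν z.1 z.2) (Set.univ ×ˢ Ω) ∧
        ContDiffOn ℝ (⊤ : ℕ∞) (fun z : ℝ × (ℝ × ℝ) => ψ z.1 z.2)
          (Set.univ ×ˢ ((Set.Ioo a₂ b₂) ×ˢ Set.Ioo (-(ε ^ 2) / 2) (ε ^ 2 / 2))) ∧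
        (∀ E : ℝ, ∀ p ∈ Ω, poisson xi₁fun (ν E) p + R E p = 0) ∧
        (∀ E : ℝ, ∀ p ∈ Ω, poisson qfun (ν E) p + S E p + ψ E (p.2.1, qfun p) = 0)) := by
  subst hΩ
  refine ⟨?_, fun R S hR hS hb => core_param a₁ b₁ a₂ b₂ ε hε R S hR hS hb⟩
  obtain ⟨ν, ψ, h1, h2, h3, h4⟩ := core_param a₁ b₁ a₂ b₂ ε hε (fun _ => r) (fun _ => s)
    (hr.comp (f := fun z : ℝ × P4 => z.2) contDiff_snd.contDiffOn (fun z hz => hz.2))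
    (hs.comp (f := fun z : ℝ × P4 => z.2) contDiff_snd.contDiffOn (fun z hz => hz.2))
    (fun _ => hbracket)
  refine ⟨ν 0, ψ 0, ?_, ?_, h3 0, h4 0⟩
  · exact h1.comp (f := fun p : P4 => ((0 : ℝ), p)) (ContDiff.contDiffOn (by fun_prop))
      (fun p hp => ⟨trivial, hp⟩)
  · exact h2.comp (f := fun p : ℝ × ℝ => ((0 : ℝ), p)) (ContDiff.contDiffOn (by fun_prop))
      (fun p hp => ⟨trivial, hp⟩)
end
end

section
/- With f_r, σ₁, τ₁ and φ as in the context, let ψ be any smooth real-valued function on a neighborhood of 0 in ℝ with ψ(0) = 0 and ψ′(0) = φ′(0) (so that the graph of ψ is a curve tangent at the origin to the radial curve {f_r = 0}). Then lim_{x → 0⁺} τ₁(x, ψ(x)) = σ₁(0, 0). -/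
open Set Filter Topology

noncomputable section

/-- The function `τ₁ = σ₁ − (1/(2π)) Im log(c₁ + i f_r(c))`, written on the right half-plane
`c₁ > 0` as `σ₁(c) − (1/(2π)) arctan(f_r(c)/c₁)`. -/
noncomputable def tau₁ (fr σ₁ : ℝ × ℝ → ℝ) (c : ℝ × ℝ) : ℝ :=
  σ₁ c - (1 / (2 * Real.pi)) * Real.arctan (fr c / c.1)

/-- The function `τ₂ = σ₂ − (1/(2π)) Re log(c₁ + i f_r(c))`, written as
`σ₂(c) − (1/(4π)) ln(c₁² + f_r(c)²)`. -/
noncomputable def tau₂ (fr σ₂ : ℝ × ℝ → ℝ) (c : ℝ × ℝ) : ℝ :=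
  σ₂ c - (1 / (4 * Real.pi)) * Real.log (c.1 ^ 2 + (fr c) ^ 2)

/-- Partial derivative `∂_x` with respect to the first variable. -/
noncomputable def pdx (f : ℝ × ℝ → ℝ) (c : ℝ × ℝ) : ℝ :=
  deriv (fun t => f (t, c.2)) c.1

/-- Partial derivative `∂_y` with respect to the second variable. -/
noncomputable def pdy (f : ℝ × ℝ → ℝ) (c : ℝ × ℝ) : ℝ :=
  deriv (fun t => f (c.1, t)) c.2

/-- The function `a₁ = τ₁ + τ₂ ∂_x f_r`. -/
noncomputable def aOne (fr σ₁ σ₂ : ℝ × ℝ → ℝ) (c : ℝ × ℝ) : ℝ :=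
  tau₁ fr σ₁ c + tau₂ fr σ₂ c * pdx fr c

/-- The function `a₂ = τ₂ ∂_y f_r`. -/
noncomputable def aTwo (fr σ₂ : ℝ × ℝ → ℝ) (c : ℝ × ℝ) : ℝ :=
  tau₂ fr σ₂ c * pdy fr c

/-- Iterated partial derivative `∂_x^ℓ ∂_y^m`. -/
noncomputable def pdmix (l m : ℕ) (f : ℝ × ℝ → ℝ) : ℝ × ℝ → ℝ :=
  pdx^[l] (pdy^[m] f)

/-- Along any curve tangent at the origin to the radial curve `{f_r = 0}`,
the function `τ₁` still tends to `σ₁(0,0)` as `x → 0⁺`. -/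
theorem tau₁_limit_along_tangent_curve
    (V : Set (ℝ × ℝ)) (hV : IsOpen V) (h0V : ((0 : ℝ), (0 : ℝ)) ∈ V)
    (fr σ₁ : ℝ × ℝ → ℝ)
    (hfr : ContDiffOn ℝ (⊤ : ℕ∞) fr V) (hσ₁ : ContDiffOn ℝ (⊤ : ℕ∞) σ₁ V)
    (hfr0 : fr (0, 0) = 0)
    (δ₀ : ℝ) (hδ₀ : 0 < δ₀) (φ : ℝ → ℝ)
    (hφ : ContDiffOn ℝ (⊤ : ℕ∞) φ (Set.Ioo (-δ₀) δ₀)) (hφ0 : φ 0 = 0)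
    (hgraph : ∀ x ∈ Set.Ioo (-δ₀) δ₀, (x, φ x) ∈ V ∧ fr (x, φ x) = 0)
    (δ₁ : ℝ) (hδ₁ : 0 < δ₁) (ψ : ℝ → ℝ)
    (hψ : ContDiffOn ℝ (⊤ : ℕ∞) ψ (Set.Ioo (-δ₁) δ₁)) (hψ0 : ψ 0 = 0)
    (hψV : ∀ x ∈ Set.Ioo (-δ₁) δ₁, (x, ψ x) ∈ V)
    (htangent : deriv ψ 0 = deriv φ 0) :
    Filter.Tendsto (fun x => tau₁ fr σ₁ (x, ψ x)) (𝓝[>] (0 : ℝ)) (𝓝 (σ₁ (0, 0))) := by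
  have hF : DifferentiableAt ℝ fr (0, 0) :=
    (hfr.contDiffAt (hV.mem_nhds h0V)).differentiableAt (by simp)
  have hφd : HasDerivAt φ (deriv φ 0) 0 :=
    ((hφ.contDiffAt (Ioo_mem_nhds (by linarith) hδ₀)).differentiableAt (by simp)).hasDerivAt
  have hψd : HasDerivAt ψ (deriv φ 0) 0 := by
    rw [← htangent]
    exact ((hψ.contDiffAt (Ioo_mem_nhds (by linarith) hδ₁)).differentiableAt (by simp)).hasDerivAt
  have key : ∀ g : ℝ → ℝ, g 0 = 0 → HasDerivAt g (deriv φ 0) 0 →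
      HasDerivAt (fun x => fr (x, g x)) (fderiv ℝ fr (0, 0) (1, deriv φ 0)) 0 := by
    intro g hg0 hg
    have h1 : HasDerivAt (fun x : ℝ => (x, g x)) (1, deriv φ 0) 0 :=
      (hasDerivAt_id (0 : ℝ)).prodMk hg
    have h2 : HasFDerivAt fr (fderiv ℝ fr (0, 0)) ((fun x : ℝ => (x, g x)) 0) := by
      simpa [hg0] using hF.hasFDerivAt
    exact h2.comp_hasDerivAt 0 h1
  have hz : fderiv ℝ fr (0, 0) (1, deriv φ 0) = 0 := by
    refine (key φ hφ0 hφd).unique ((hasDerivAt_const (0 : ℝ) (0 : ℝ)).congr_of_eventuallyEq ?_)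
    filter_upwards [Ioo_mem_nhds (show -δ₀ < 0 by linarith) hδ₀] with x hx
    exact (hgraph x hx).2
  have hk := key ψ hψ0 hψd
  rw [hz, hasDerivAt_iff_tendsto_slope] at hk
  have hlim : Tendsto (fun x => fr (x, ψ x) / x) (𝓝[>] (0 : ℝ)) (𝓝 0) := by
    refine (hk.mono_left (nhdsWithin_mono _ fun x hx => ne_of_gt hx)).congr fun x => ?_
    simp [slope_def_field, hψ0, hfr0]
  have hs : Tendsto (fun x => σ₁ (x, ψ x)) (𝓝[>] (0 : ℝ)) (𝓝 (σ₁ (0, 0))) := by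
    have hc : ContinuousAt σ₁ (0, 0) := (hσ₁.contDiffAt (hV.mem_nhds h0V)).continuousAt
    have hp : Tendsto (fun x : ℝ => (x, ψ x)) (𝓝 0) (𝓝 (0, 0)) := by
      have := (continuousAt_id (x := (0 : ℝ))).prodMk hψd.continuousAt
      simpa [ContinuousAt, hψ0] using this
    exact (hc.tendsto.comp hp).mono_left nhdsWithin_le_nhds
  have ha := (Real.continuous_arctan.tendsto 0).comp hlim
  have := hs.sub (ha.const_mul (1 / (2 * Real.pi)))
  simpa [tau₁, Function.comp_def] using this
end
end

section
/- With f_r, σ₂, τ₂ and φ as in the context, the function x ↦ τ₂(x, φ(x)) + (ln x)/(2π), defined for small x > 0, extends smoothly at x = 0, with value σ₂(0, 0) at x = 0. Moreover, for any smooth real-valued function ψ on a neighborhood of 0 in ℝ with ψ(0) = 0 and ψ′(0) = φ′(0), one has lim_{x → 0⁺} ( τ₂(x, ψ(x)) + (ln x)/(2π) ) = σ₂(0, 0). -/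
open Set Filter Topology

noncomputable section

/-- Along the radial curve `{f_r = 0}` (graph of `φ`), the function
`x ↦ τ₂(x, φ(x)) + ln x/(2π)` extends smoothly at `x = 0` with value `σ₂(0,0)`; along any
tangent curve at the origin, the same expression tends to `σ₂(0,0)` as `x → 0⁺`. -/
theorem tau₂_extends_smoothly_along_radial_curve
    (V : Set (ℝ × ℝ)) (hV : IsOpen V) (h0V : ((0 : ℝ), (0 : ℝ)) ∈ V)
    (fr σ₂ : ℝ × ℝ → ℝ)
    (hfr : ContDiffOn ℝ (⊤ : ℕ∞) fr V) (hσ₂ : ContDiffOn ℝ (⊤ : ℕ∞) σ₂ V)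
    (hfr0 : fr (0, 0) = 0)
    (δ₀ : ℝ) (hδ₀ : 0 < δ₀) (φ : ℝ → ℝ)
    (hφ : ContDiffOn ℝ (⊤ : ℕ∞) φ (Set.Ioo (-δ₀) δ₀)) (hφ0 : φ 0 = 0)
    (hgraph : ∀ x ∈ Set.Ioo (-δ₀) δ₀, (x, φ x) ∈ V ∧ fr (x, φ x) = 0) :
    (∃ δ > (0 : ℝ), ∃ g : ℝ → ℝ, ContDiffOn ℝ (⊤ : ℕ∞) g (Set.Ioo (-δ) δ) ∧
      (∀ x ∈ Set.Ioo (0 : ℝ) δ,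
        g x = tau₂ fr σ₂ (x, φ x) + Real.log x / (2 * Real.pi)) ∧
      g 0 = σ₂ (0, 0)) ∧
    (∀ δ₁ : ℝ, 0 < δ₁ → ∀ ψ : ℝ → ℝ,
      ContDiffOn ℝ (⊤ : ℕ∞) ψ (Set.Ioo (-δ₁) δ₁) → ψ 0 = 0 →
      (∀ x ∈ Set.Ioo (-δ₁) δ₁, (x, ψ x) ∈ V) →
      deriv ψ 0 = deriv φ 0 →
      Filter.Tendsto (fun x => tau₂ fr σ₂ (x, ψ x) + Real.log x / (2 * Real.pi))
        (𝓝[>] (0 : ℝ)) (𝓝 (σ₂ (0, 0)))) := by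
  have hn : ((⊤ : ℕ∞) : WithTop ℕ∞) ≠ 0 := by simp
  have hmem : ∀ d : ℝ, 0 < d → Set.Ioo (-d) d ∈ 𝓝 (0 : ℝ) := fun d hd =>
    Ioo_mem_nhds (by linarith) hd
  have hpi := Real.pi_pos
  refine ⟨⟨δ₀, hδ₀, fun x => σ₂ (x, φ x), ?_, ?_, ?_⟩, ?_⟩
  · exact hσ₂.comp (contDiffOn_id.prodMk hφ) (fun x hx => (hgraph x hx).1)
  · intro x hx
    have hx' := hgraph x ⟨by linarith [hx.1], hx.2⟩
    simp only [tau₂, hx'.2]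
    have : Real.log (x ^ 2 + 0 ^ 2) = 2 * Real.log x := by
      rw [show x ^ 2 + (0 : ℝ) ^ 2 = x ^ 2 by ring, Real.log_pow]
      norm_num
    rw [this]
    field_simp
    ring
  · simp [hφ0]
  · intro δ₁ hδ₁ ψ hψ hψ0 hψV hd
    have hV0 : V ∈ 𝓝 ((0 : ℝ), (0 : ℝ)) := hV.mem_nhds h0V
    have hF : HasFDerivAt fr (fderiv ℝ fr (0, 0)) (0, 0) :=
      ((hfr.contDiffAt hV0).differentiableAt hn).hasFDerivAt
    have hφd : HasDerivAt φ (deriv φ 0) 0 :=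
      ((hφ.contDiffAt (hmem δ₀ hδ₀)).differentiableAt hn).hasDerivAt
    have hψd : HasDerivAt ψ (deriv φ 0) 0 := by
      rw [← hd]
      exact ((hψ.contDiffAt (hmem δ₁ hδ₁)).differentiableAt hn).hasDerivAt
    have key : ∀ χ : ℝ → ℝ, χ 0 = 0 → HasDerivAt χ (deriv φ 0) 0 →
        HasDerivAt (fun x => fr (x, χ x)) (fderiv ℝ fr (0, 0) (1, deriv φ 0)) 0 := by
      intro χ h0 hχ
      have h1 : HasDerivAt (fun x => (x, χ x)) ((1 : ℝ), deriv φ 0) 0 :=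
        (hasDerivAt_id (0 : ℝ)).prodMk hχ
      have h2 : HasFDerivAt fr (fderiv ℝ fr (0, 0)) ((fun x => (x, χ x)) (0 : ℝ)) := by
        simpa [h0] using hF
      exact h2.comp_hasDerivAt (0 : ℝ) h1
    have hz : fderiv ℝ fr (0, 0) (1, deriv φ 0) = 0 := by
      have h1 := key φ hφ0 hφd
      have h2 : HasDerivAt (fun x => fr (x, φ x)) 0 0 := by
        refine (hasDerivAt_const (0 : ℝ) (0 : ℝ)).congr_of_eventuallyEq ?_
        filter_upwards [hmem δ₀ hδ₀] with x hx
        exact (hgraph x hx).2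
      exact h1.unique h2
    have hh := key ψ hψ0 hψd
    rw [hz, hasDerivAt_iff_tendsto_slope] at hh
    have hq : Tendsto (fun x => fr (x, ψ x) / x) (𝓝[>] (0 : ℝ)) (𝓝 0) := by
      refine (hh.mono_left (nhdsWithin_mono _ fun x hx => ne_of_gt hx)).congr ?_
      intro x
      simp [slope_def_field, hψ0, hfr0]
    have hl : Tendsto (fun x => Real.log (1 + (fr (x, ψ x) / x) ^ 2)) (𝓝[>] (0 : ℝ)) (𝓝 0) := by
      have h1 : Tendsto (fun x => 1 + (fr (x, ψ x) / x) ^ 2) (𝓝[>] (0 : ℝ)) (𝓝 1) := by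
        simpa using (hq.pow 2).const_add 1
      simpa using h1.log one_ne_zero
    have hs : Tendsto (fun x => σ₂ (x, ψ x)) (𝓝[>] (0 : ℝ)) (𝓝 (σ₂ (0, 0))) := by
      have hc : ContinuousAt σ₂ (0, 0) := (hσ₂.contDiffAt hV0).continuousAt
      have hp : Tendsto (fun x => (x, ψ x)) (𝓝 (0 : ℝ)) (𝓝 ((0 : ℝ), (0 : ℝ))) := by
        have := (continuousAt_id (x := (0 : ℝ))).prodMk hψd.continuousAt
        simpa [ContinuousAt, hψ0] using this
      exact (hc.tendsto.comp hp).mono_left nhdsWithin_le_nhds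
    have hfin := hs.sub (hl.const_mul (1 / (4 * Real.pi)))
    rw [mul_zero, sub_zero] at hfin
    refine hfin.congr' ?_
    filter_upwards [self_mem_nhdsWithin] with x hx
    have hx0 : (0 : ℝ) < x := hx
    have e : x ^ 2 + fr (x, ψ x) ^ 2 = x ^ 2 * (1 + (fr (x, ψ x) / x) ^ 2) := by
      field_simp
    simp only [tau₂]
    rw [e, Real.log_mul (by positivity) (by positivity), Real.log_pow]
    field_simp
    push_cast
    ring
end
end

section
/- With f_r, σ₁, σ₂, τ₁, τ₂, a₁, a₂ as in the context, for any fixed μ > 1 one has, as x → 0⁺: ∂_x f_r(0,0) = 2π·(a₁(x, 0) − a₁(μx, 0))/ln μ + O(x·ln x), and ∂_y f_r(0,0) = 2π·(a₂(x, 0) − a₂(μx, 0))/ln μ + O(x·ln x). -/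
open Set Filter Topology

noncomputable section

open Asymptotics

lemma rl_diff {h : ℝ → ℝ} (hh : DifferentiableAt ℝ h 0) :
    (fun x => h x - h 0) =O[𝓝[>] 0] (fun x => x) := by
  have := hh.isBigO_sub
  simpa using this.mono nhdsWithin_le_nhds

lemma rl_comp {h g : ℝ → ℝ} {g0 : ℝ} (hh : DifferentiableAt ℝ h g0)
    (hg : (fun x => g x - g0) =O[𝓝[>] 0] (fun x : ℝ => x)) :
    (fun x => h (g x) - h g0) =O[𝓝[>] 0] (fun x : ℝ => x) := by
  have h0 : Tendsto (fun x : ℝ => x) (𝓝[>] 0) (𝓝 0) := nhdsWithin_le_nhds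
  have ht : Tendsto g (𝓝[>] 0) (𝓝 g0) := tendsto_sub_nhds_zero_iff.1 (hg.trans_tendsto h0)
  exact (hh.isBigO_sub.comp_tendsto ht).trans hg

lemma rl_quot {f : ℝ → ℝ} (hf : ContDiffAt ℝ 2 f 0) (h0 : f 0 = 0) :
    (fun x => f x / x - deriv f 0) =O[𝓝[>] 0] (fun x : ℝ => x) := by
  have hd : ContDiffAt ℝ 1 (deriv f) 0 := hf.derivWithin (m := 1) (by norm_num)
  have h1 := (hd.differentiableAt (by norm_num)).isBigO_sub
  obtain ⟨C, hC, hb⟩ := h1.exists_pos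
  have hdiff : ∀ᶠ x in 𝓝 (0:ℝ), DifferentiableAt ℝ f x := by
    filter_upwards [hf.eventually (by norm_num)] with x hx
    exact hx.differentiableAt (by norm_num)
  obtain ⟨δ, hδ, hball⟩ := Metric.eventually_nhds_iff.1 (hb.bound.and hdiff)
  refine IsBigO.of_bound C ?_
  filter_upwards [Ioo_mem_nhdsGT hδ] with x hx
  have key : ‖(f x - deriv f 0 * x) - (f 0 - deriv f 0 * 0)‖ ≤ (C * x) * ‖x - 0‖ := by
    refine Convex.norm_image_sub_le_of_norm_hasDerivWithin_le (s := Icc 0 x)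
      (f := fun t => f t - deriv f 0 * t) (f' := fun t => deriv f t - deriv f 0)
      ?_ ?_ (convex_Icc 0 x) ⟨le_rfl, hx.1.le⟩ ⟨hx.1.le, le_rfl⟩
    · intro t ht
      have := (hball (y := t) (by rw [Real.dist_eq, sub_zero, abs_of_nonneg ht.1]; exact ht.2.trans_lt hx.2)).2
      have h2 := this.hasDerivAt.fun_sub ((hasDerivAt_id t).const_mul (deriv f 0))
      simpa using h2.hasDerivWithinAt
    · intro t ht
      have := (hball (y := t) (by rw [Real.dist_eq, sub_zero, abs_of_nonneg ht.1]; exact ht.2.trans_lt hx.2)).1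
      refine this.trans ?_
      rw [sub_zero, Real.norm_eq_abs, abs_of_nonneg ht.1]
      exact mul_le_mul_of_nonneg_left ht.2 hC.le
  have hx0 := hx.1
  have e : f x / x - deriv f 0 = (f x - deriv f 0 * x) / x := by field_simp
  rw [e, norm_div, Real.norm_eq_abs x, abs_of_pos hx0, div_le_iff₀ hx0]
  simpa [h0, abs_of_pos hx0] using key

lemma rl_key {S T p A : ℝ → ℝ} {S0 T0 p0 μ : ℝ} (hμ : 1 < μ)
    (hS : (fun x => S x - S0) =O[𝓝[>] 0] (fun x : ℝ => x))
    (hT : (fun x => T x - T0) =O[𝓝[>] 0] (fun x : ℝ => x))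
    (hp : (fun x => p x - p0) =O[𝓝[>] 0] (fun x : ℝ => x))
    (hA : ∀ᶠ x in 𝓝[>] 0, A x = S x + (T x - 1 / (2 * Real.pi) * Real.log x) * p x) :
    (fun x => p0 - 2 * Real.pi * (A x - A (μ * x)) / Real.log μ) =O[𝓝[>] 0]
      (fun x : ℝ => x * Real.log x) := by
  have hμ0 : 0 < μ := by linarith
  have hlμ : 0 < Real.log μ := Real.log_pos hμ
  have h0 : Tendsto (fun x : ℝ => x) (𝓝[>] 0) (𝓝 0) := nhdsWithin_le_nhds
  have hpos : ∀ᶠ x : ℝ in 𝓝[>] 0, 0 < x := self_mem_nhdsWithin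
  have hm : Tendsto (fun x : ℝ => μ * x) (𝓝[>] 0) (𝓝[>] 0) := by
    refine tendsto_nhdsWithin_iff.2 ⟨by simpa using h0.const_mul μ, ?_⟩
    filter_upwards [hpos] with x hx
    exact mul_pos hμ0 hx
  have hmO : (fun x : ℝ => μ * x) =O[𝓝[>] 0] (fun x : ℝ => x) :=
    (isBigO_refl _ _).const_mul_left μ
  have hlog1 : (fun _ : ℝ => (1:ℝ)) =O[𝓝[>] 0] Real.log := by
    refine IsBigO.of_bound 1 ?_
    filter_upwards [Real.tendsto_log_nhdsGT_zero.eventually (eventually_le_atBot (-1))] with x hx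
    rw [Real.norm_eq_abs, Real.norm_eq_abs, abs_of_neg (by linarith : Real.log x < 0)]
    simp; linarith
  have hxl : (fun x : ℝ => x) =O[𝓝[>] 0] (fun x : ℝ => x * Real.log x) := by
    simpa using (isBigO_refl (fun x : ℝ => x) (𝓝[>] 0)).mul hlog1
  have hTl : (fun x => T x - 1 / (2 * Real.pi) * Real.log x) =O[𝓝[>] 0] Real.log := by
    have h1 : (fun x => T x - T0) =O[𝓝[>] 0] Real.log :=
      (hT.trans (h0.isBigO_one ℝ)).trans hlog1
    have h2 : (fun _ : ℝ => T0) =O[𝓝[>] 0] Real.log := by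
      simpa using hlog1.const_mul_left T0
    have h3 := (isBigO_refl Real.log (𝓝[>] 0)).const_mul_left (1 / (2 * Real.pi))
    simpa using (h1.add h2).sub h3
  have hlm : (fun x : ℝ => Real.log (μ * x)) =O[𝓝[>] 0] Real.log := by
    have : (fun x : ℝ => Real.log μ + Real.log x) =O[𝓝[>] 0] Real.log := by
      refine IsBigO.add ?_ (isBigO_refl _ _)
      simpa using hlog1.const_mul_left (Real.log μ)
    refine this.congr' ?_ EventuallyEq.rfl
    filter_upwards [hpos] with x hx
    rw [Real.log_mul hμ0.ne' hx.ne']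
  have hSm := (hS.comp_tendsto hm).trans hmO
  have hTm := (hT.comp_tendsto hm).trans hmO
  have hpm := (hp.comp_tendsto hm).trans hmO
  have hTlm := (hTl.comp_tendsto hm).trans hlm
  have B1 := (hS.sub hSm).trans hxl
  have B2 := ((hT.sub hTm).const_mul_left p0).trans hxl
  have B3 := hp.mul hTl
  have B4 := hpm.mul hTlm
  have B := (((B1.add B2).add B3).sub B4).const_mul_left (-(2 * Real.pi / Real.log μ))
  refine B.congr' ?_ EventuallyEq.rfl
  filter_upwards [hpos, hA, hm.eventually hA] with x hx h1 h2
  have hpi := Real.pi_pos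
  rw [h1, h2]
  simp only [Function.comp, Real.log_mul hμ0.ne' hx.ne']
  field_simp
  ring

/-- Recovery of the linear part of the Eliasson diffeomorphism: for fixed
`μ > 1`, `∂_x f_r(0) = 2π (a₁(x,0) − a₁(μx,0))/ln μ + O(x ln x)` and
`∂_y f_r(0) = 2π (a₂(x,0) − a₂(μx,0))/ln μ + O(x ln x)` as `x → 0⁺`. -/
theorem recover_linear_part_of_eliasson
    (V : Set (ℝ × ℝ)) (hV : IsOpen V) (h0V : ((0 : ℝ), (0 : ℝ)) ∈ V)
    (fr σ₁ σ₂ : ℝ × ℝ → ℝ)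
    (hfr : ContDiffOn ℝ (⊤ : ℕ∞) fr V) (hσ₁ : ContDiffOn ℝ (⊤ : ℕ∞) σ₁ V) (hσ₂ : ContDiffOn ℝ (⊤ : ℕ∞) σ₂ V)
    (hfr0 : fr (0, 0) = 0)
    (μ : ℝ) (hμ : 1 < μ) :
    ∃ C > (0 : ℝ), ∃ δ > (0 : ℝ), ∀ x ∈ Set.Ioo (0 : ℝ) δ,
      |pdx fr (0, 0) -
          2 * Real.pi * (aOne fr σ₁ σ₂ (x, 0) - aOne fr σ₁ σ₂ (μ * x, 0)) / Real.log μ|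
        ≤ C * x * |Real.log x| ∧
      |pdy fr (0, 0) -
          2 * Real.pi * (aTwo fr σ₂ (x, 0) - aTwo fr σ₂ (μ * x, 0)) / Real.log μ|
        ≤ C * x * |Real.log x| := by
  have hmem : V ∈ 𝓝 ((0:ℝ), (0:ℝ)) := hV.mem_nhds h0V
  have cfr : ContDiffAt ℝ 2 fr (0, 0) := (hfr.contDiffAt hmem).of_le (WithTop.coe_le_coe.2 (le_top : (2 : ℕ∞) ≤ ⊤))
  have cs1 : ContDiffAt ℝ 2 σ₁ (0, 0) := (hσ₁.contDiffAt hmem).of_le (WithTop.coe_le_coe.2 (le_top : (2 : ℕ∞) ≤ ⊤))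
  have cs2 : ContDiffAt ℝ 2 σ₂ (0, 0) := (hσ₂.contDiffAt hmem).of_le (WithTop.coe_le_coe.2 (le_top : (2 : ℕ∞) ≤ ⊤))
  have ci : ContDiffAt ℝ 2 (fun t : ℝ => (t, (0:ℝ))) 0 := by fun_prop
  have cf : ContDiffAt ℝ 2 (fun t : ℝ => fr (t, 0)) 0 :=
    ContDiffAt.comp (g := fr) (f := fun t : ℝ => (t, (0:ℝ))) 0 cfr ci
  have c1 : ContDiffAt ℝ 2 (fun t : ℝ => σ₁ (t, 0)) 0 :=
    ContDiffAt.comp (g := σ₁) (f := fun t : ℝ => (t, (0:ℝ))) 0 cs1 ci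
  have c2 : ContDiffAt ℝ 2 (fun t : ℝ => σ₂ (t, 0)) 0 :=
    ContDiffAt.comp (g := σ₂) (f := fun t : ℝ => (t, (0:ℝ))) 0 cs2 ci
  have hg := rl_quot cf hfr0
  have hS1 := rl_diff (c1.differentiableAt (by norm_num))
  have hS2 := rl_diff (c2.differentiableAt (by norm_num))
  have hpx : (fun x => pdx fr (x, 0) - pdx fr (0, 0)) =O[𝓝[>] 0] (fun x : ℝ => x) := by
    have hd : ContDiffAt ℝ 1 (deriv (fun t : ℝ => fr (t, 0))) 0 :=
      cf.derivWithin (m := 1) (by norm_num)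
    exact rl_diff (hd.differentiableAt (by norm_num))
  have hpy : (fun x => pdy fr (x, 0) - pdy fr (0, 0)) =O[𝓝[>] 0] (fun x : ℝ => x) := by
    have hfd : ContDiffAt ℝ 1 (fderiv ℝ fr) (0, 0) := cfr.fderiv_right (m := 1) (by norm_num)
    have hfd1 : DifferentiableAt ℝ (fun x : ℝ => fderiv ℝ fr (x, 0)) 0 :=
      DifferentiableAt.comp (g := fderiv ℝ fr) (f := fun t : ℝ => (t, (0:ℝ))) 0
        (hfd.differentiableAt (by norm_num)) (ci.differentiableAt (by norm_num))
    have hfd2 : DifferentiableAt ℝ (fun x : ℝ => fderiv ℝ fr (x, 0) (0, 1)) 0 :=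
      hfd1.clm_apply (differentiableAt_const _)
    have hev : ∀ᶠ x : ℝ in 𝓝 0, pdy fr (x, 0) = fderiv ℝ fr (x, 0) (0, 1) := by
      have hc := ci.continuousAt.eventually (cfr.eventually (by norm_num))
      filter_upwards [hc] with x hx
      have h1 : HasDerivAt (fun t : ℝ => (x, t)) ((0:ℝ), (1:ℝ)) 0 :=
        (hasDerivAt_const 0 x).prodMk (hasDerivAt_id 0)
      have h2 := (hx.differentiableAt (by norm_num)).hasFDerivAt
      exact (HasFDerivAt.comp_hasDerivAt (l := fr) (0:ℝ) h2 h1).deriv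
    exact rl_diff (h := fun x => pdy fr (x, 0)) (hfd2.congr_of_eventuallyEq hev)
  have hat := rl_comp (h := Real.arctan) (Real.differentiable_arctan _) hg
  have hlg := rl_comp (h := fun u => Real.log (1 + u ^ 2))
    (DifferentiableAt.log (by fun_prop) (by positivity)) hg
  have hS := hS1.sub (hat.const_mul_left (1 / (2 * Real.pi)))
  have hT := hS2.sub (hlg.const_mul_left (1 / (4 * Real.pi)))
  set d := deriv (fun t : ℝ => fr (t, 0)) 0 with hd
  have hpos : ∀ᶠ x : ℝ in 𝓝[>] 0, 0 < x := self_mem_nhdsWithin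
  have hS' : (fun x => tau₁ fr σ₁ (x, 0) - (σ₁ (0, 0) - 1 / (2 * Real.pi) * Real.arctan d))
      =O[𝓝[>] 0] (fun x : ℝ => x) := by
    refine hS.congr_left fun x => ?_
    simp only [tau₁]; ring
  have hT' : (fun x => (σ₂ (x, 0) - 1 / (4 * Real.pi) * Real.log (1 + (fr (x, 0) / x) ^ 2))
      - (σ₂ (0, 0) - 1 / (4 * Real.pi) * Real.log (1 + d ^ 2)))
      =O[𝓝[>] 0] (fun x : ℝ => x) := by
    refine hT.congr_left fun x => ?_
    ring
  have htau : ∀ᶠ x : ℝ in 𝓝[>] 0, tau₂ fr σ₂ (x, 0) =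
      (σ₂ (x, 0) - 1 / (4 * Real.pi) * Real.log (1 + (fr (x, 0) / x) ^ 2))
        - 1 / (2 * Real.pi) * Real.log x := by
    filter_upwards [hpos] with x hx
    have e : x ^ 2 + fr (x, 0) ^ 2 = x ^ 2 * (1 + (fr (x, 0) / x) ^ 2) := by field_simp
    have hne : (1 + (fr (x, 0) / x) ^ 2) ≠ 0 := by positivity
    have hpi := Real.pi_pos
    simp only [tau₂]
    rw [e, Real.log_mul (by positivity) hne, Real.log_pow]
    push_cast
    field_simp
    ring
  have K1 := rl_key (A := fun x => aOne fr σ₁ σ₂ (x, 0)) hμ hS' hT' hpx (by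
    filter_upwards [htau] with x hx
    simp only [aOne, hx])
  have hZ : (fun x : ℝ => (fun _ : ℝ => (0:ℝ)) x - 0) =O[𝓝[>] 0] (fun x : ℝ => x) := by
    simpa using isBigO_zero _ _
  have K2 := rl_key (A := fun x => aTwo fr σ₂ (x, 0)) hμ hZ hT' hpy (by
    filter_upwards [htau] with x hx
    simp only [aTwo, hx, zero_add])
  obtain ⟨C1, hC1, b1⟩ := K1.exists_pos
  obtain ⟨C2, hC2, b2⟩ := K2.exists_pos
  obtain ⟨δ, hδ, hsub⟩ := mem_nhdsGT_iff_exists_Ioo_subset.1 (b1.bound.and b2.bound)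
  refine ⟨C1 + C2, by positivity, δ, hδ, fun x hx => ?_⟩
  obtain ⟨h1, h2⟩ := hsub hx
  have hx0 : 0 < x := hx.1
  simp only [Real.norm_eq_abs, abs_mul x, abs_of_pos hx0] at h1 h2
  have hnn : 0 ≤ x * |Real.log x| := by positivity
  constructor
  · refine h1.trans ?_
    nlinarith
  · refine h2.trans ?_
    nlinarith
end
end

section
/- With f_r, σ₁, σ₂, τ₁, τ₂, a₁, a₂ as in the context, fix μ > 0 and define g_μ(x) = a₁(x, μx) + μ·a₂(x, μx) for small x > 0. Then g_μ admits an asymptotic expansion of the form g_μ(x) ~ Σ_{n ≥ 0} x^n·(c_n(μ) + d_n(μ)·ln x) as x → 0⁺; that is, there exist real numbers c_n(μ), d_n(μ) (n ≥ 0) such that for every N ≥ 0, g_μ(x) − Σ_{n=0}^N x^n·(c_n(μ) + d_n(μ)·ln x) = O(x^{N+1}·|ln x|) as x → 0⁺. Moreover, for every n ≥ 0, d_n(μ) = −(1/(2π·n!))·Σ_{ℓ=0}^{n+1} binom(n+1, ℓ)·μ^{n+1−ℓ}·∂_x^ℓ ∂_y^{n+1−ℓ} f_r(0,0). -/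
open Set Filter Topology

noncomputable section

open scoped ContDiff

lemma aux_globalize {V : Set (ℝ × ℝ)} (hV : IsOpen V) (h0V : ((0 : ℝ), (0 : ℝ)) ∈ V)
    {f : ℝ × ℝ → ℝ} (hf : ContDiffOn ℝ (⊤ : ℕ∞) f V) :
    ∃ F : ℝ × ℝ → ℝ, ContDiff ℝ ∞ F ∧ F =ᶠ[𝓝 (0, 0)] f := by
  obtain ⟨r, hr, hrV⟩ := Metric.isOpen_iff.1 hV _ h0V
  let b : ContDiffBump ((0 : ℝ), (0 : ℝ)) := ⟨r / 4, r / 2, by positivity, by linarith⟩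
  refine ⟨fun x => b x * f x, ?_, ?_⟩
  · rw [contDiff_iff_contDiffAt]
    intro x
    by_cases hx : x ∈ V
    · exact b.contDiff.contDiffAt.mul (hf.contDiffAt (hV.mem_nhds hx))
    · have hx' : x ∉ tsupport b := by
        rw [b.tsupport_eq]
        intro h
        refine hx (hrV (Metric.closedBall_subset_ball ?_ h))
        show r / 2 < r
        linarith
      have h0 : (fun x => b x * f x) =ᶠ[𝓝 x] fun _ => 0 := by
        filter_upwards [notMem_tsupport_iff_eventuallyEq.1 hx'] with y hy
        simp [hy]
      exact contDiffAt_const.congr_of_eventuallyEq h0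
  · filter_upwards [b.eventuallyEq_one] with y hy
    simp [hy]

lemma aux_int_cont {F : ℝ → ℝ} (hF : Continuous F) (m : ℕ) :
    Continuous (fun x : ℝ => ∫ t in (0:ℝ)..1, t ^ m * F (t * x)) := by
  apply intervalIntegral.continuous_parametric_intervalIntegral_of_continuous'
  fun_prop

lemma aux_int_deriv {F : ℝ → ℝ} (hF : ContDiff ℝ ∞ F) (m : ℕ) (x₀ : ℝ) :
    HasDerivAt (fun x : ℝ => ∫ t in (0:ℝ)..1, t ^ m * F (t * x))
      (∫ t in (0:ℝ)..1, t ^ (m + 1) * deriv F (t * x₀)) x₀ := by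
  have hF' : Continuous (deriv F) := hF.continuous_deriv (by simp)
  have hFc : Continuous F := hF.continuous
  have hK : IsCompact (Icc (0:ℝ) 1 ×ˢ Metric.closedBall x₀ 1) :=
    isCompact_Icc.prod (isCompact_closedBall _ _)
  obtain ⟨C, hC⟩ := hK.exists_bound_of_continuousOn
    (f := fun p : ℝ × ℝ => p.1 ^ (m + 1) * deriv F (p.1 * p.2)) (by fun_prop)
  refine (intervalIntegral.hasDerivAt_integral_of_dominated_loc_of_deriv_le
    (μ := MeasureTheory.volume) (a := 0) (b := 1) (x₀ := x₀) (s := Metric.ball x₀ 1)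
    (F := fun x t => t ^ m * F (t * x))
    (F' := fun x t => t ^ (m + 1) * deriv F (t * x)) (bound := fun _ => C)
    (Metric.ball_mem_nhds _ one_pos) ?_ ?_ ?_ ?_ ?_ ?_).2
  · refine Eventually.of_forall fun x => ?_
    exact Continuous.aestronglyMeasurable (by fun_prop)
  · exact Continuous.intervalIntegrable (by fun_prop) _ _
  · exact Continuous.aestronglyMeasurable (by fun_prop)
  · refine Eventually.of_forall fun t ht x hx => ?_
    rw [uIoc_of_le zero_le_one] at ht
    exact hC (t, x) ⟨⟨ht.1.le, ht.2⟩, Metric.ball_subset_closedBall hx⟩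
  · exact intervalIntegrable_const
  · refine Eventually.of_forall fun t ht x hx => ?_
    have h1 : HasDerivAt F (deriv F (t * x)) (t * x) :=
      (hF.differentiable (by simp) _).hasDerivAt
    have h2 : HasDerivAt (fun x => t * x) t x := by
      simpa using (hasDerivAt_id x).const_mul t
    have h3 := (h1.comp x h2).const_mul (t ^ m)
    refine h3.congr_deriv ?_
    ring

lemma aux_int_contDiff (n : ℕ) : ∀ {F : ℝ → ℝ} (_ : ContDiff ℝ ∞ F) (m : ℕ),
    ContDiff ℝ n (fun x : ℝ => ∫ t in (0:ℝ)..1, t ^ m * F (t * x)) := by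
  induction n with
  | zero => intro F hF m; exact contDiff_zero.2 (aux_int_cont hF.continuous m)
  | succ n ih =>
    intro F hF m
    push_cast
    rw [contDiff_succ_iff_deriv]
    refine ⟨fun x => (aux_int_deriv hF m x).differentiableAt, by simp, ?_⟩
    have : deriv (fun x : ℝ => ∫ t in (0:ℝ)..1, t ^ m * F (t * x)) =
        fun x => ∫ t in (0:ℝ)..1, t ^ (m + 1) * deriv F (t * x) :=
      funext fun x => (aux_int_deriv hF m x).deriv
    rw [this]
    exact ih (contDiff_infty_iff_deriv.1 hF).2 (m + 1)

lemma aux_hadamard {H : ℝ → ℝ} (hH : ContDiff ℝ ∞ H) (h0 : H 0 = 0) :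
    ∃ k : ℝ → ℝ, ContDiff ℝ ∞ k ∧ ∀ x, H x = x * k x := by
  have hd := (contDiff_infty_iff_deriv.1 hH).2
  refine ⟨fun x => ∫ t in (0:ℝ)..1, t ^ 0 * deriv H (t * x),
    contDiff_infty.2 fun n => aux_int_contDiff n hd 0, fun x => ?_⟩
  have hc : Continuous (deriv H) := hd.continuous
  have h := intervalIntegral.integral_eq_sub_of_hasDerivAt (a := 0) (b := 1)
    (f := fun t => H (t * x)) (f' := fun t => x * deriv H (t * x)) (fun t _ => by
      have h1 : HasDerivAt H (deriv H (t * x)) (t * x) :=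
        (hH.differentiable (by simp) _).hasDerivAt
      have h2 : HasDerivAt (fun t => t * x) x t := by
        simpa using (hasDerivAt_id t).mul_const x
      refine (h1.comp t h2).congr_deriv ?_
      ring) (Continuous.intervalIntegrable (by fun_prop) _ _)
  simp only [intervalIntegral.integral_const_mul, one_mul, zero_mul, h0, sub_zero] at h
  simpa using h.symm

lemma aux_taylor {f : ℝ → ℝ} (hf : ContDiff ℝ ∞ f) (N : ℕ) :
    ∃ C : ℝ, ∀ x ∈ Icc (0:ℝ) 1,
      |f x - ∑ n ∈ Finset.range (N + 1), x ^ n * (iteratedDeriv n f 0 / n.factorial)|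
        ≤ C * x ^ (N + 1) := by
  obtain ⟨C, hC⟩ := exists_taylor_mean_remainder_bound (f := f) (a := 0) (b := 1) (n := N)
    zero_le_one (hf.of_le (by exact_mod_cast le_top)).contDiffOn
  refine ⟨C, fun x hx => ?_⟩
  have := hC x hx
  rw [taylor_within_apply, Real.norm_eq_abs, sub_zero] at this
  convert this using 5 with n hn
  rw [iteratedDerivWithin_eq_iteratedDeriv (uniqueDiffOn_Icc zero_lt_one)
    (hf.contDiffAt.of_le (by exact_mod_cast le_top)) (by simp)]
  simp only [smul_eq_mul]
  ring

lemma aux_pdx_eq {F : ℝ × ℝ → ℝ} (hF : ContDiff ℝ ∞ F) :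
    pdx F = fun c => fderiv ℝ F c (1, 0) := by
  funext c
  have h1 : HasFDerivAt F (fderiv ℝ F c) (c.1, c.2) :=
    (hF.differentiable (by simp) c).hasFDerivAt
  exact (h1.comp_hasDerivAt c.1 ((hasDerivAt_id c.1).prodMk (hasDerivAt_const c.1 c.2))).deriv

lemma aux_pdy_eq {F : ℝ × ℝ → ℝ} (hF : ContDiff ℝ ∞ F) :
    pdy F = fun c => fderiv ℝ F c (0, 1) := by
  funext c
  have h1 : HasFDerivAt F (fderiv ℝ F c) (c.1, c.2) :=
    (hF.differentiable (by simp) c).hasFDerivAt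
  exact (h1.comp_hasDerivAt c.2 ((hasDerivAt_const c.2 c.1).prodMk (hasDerivAt_id c.2))).deriv

lemma aux_fderiv_smooth {F : ℝ × ℝ → ℝ} (hF : ContDiff ℝ ∞ F) :
    ContDiff ℝ ∞ (fderiv ℝ F) := hF.fderiv_right (by simp)

lemma aux_pdx_smooth {F : ℝ × ℝ → ℝ} (hF : ContDiff ℝ ∞ F) : ContDiff ℝ ∞ (pdx F) := by
  rw [aux_pdx_eq hF]
  exact (aux_fderiv_smooth hF).clm_apply contDiff_const

lemma aux_pdy_smooth {F : ℝ × ℝ → ℝ} (hF : ContDiff ℝ ∞ F) : ContDiff ℝ ∞ (pdy F) := by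
  rw [aux_pdy_eq hF]
  exact (aux_fderiv_smooth hF).clm_apply contDiff_const

lemma aux_comm {F : ℝ × ℝ → ℝ} (hF : ContDiff ℝ ∞ F) : pdy (pdx F) = pdx (pdy F) := by
  rw [aux_pdy_eq (aux_pdx_smooth hF), aux_pdx_eq (aux_pdy_smooth hF), aux_pdx_eq hF,
    aux_pdy_eq hF]
  funext c
  have hd : DifferentiableAt ℝ (fderiv ℝ F) c := (aux_fderiv_smooth hF).differentiable (by simp) c
  have hs : IsSymmSndFDerivAt ℝ F c :=
    (contDiff_infty.1 hF 2).contDiffAt.isSymmSndFDerivAt (by simp)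
  rw [fderiv_clm_apply hd (differentiableAt_const _), fderiv_clm_apply hd (differentiableAt_const _)]
  simp
  exact hs.eq _ _

lemma aux_pdy_iter_smooth {F : ℝ × ℝ → ℝ} (hF : ContDiff ℝ ∞ F) (m : ℕ) :
    ContDiff ℝ ∞ (pdy^[m] F) := by
  induction m with
  | zero => exact hF
  | succ m ih => rw [Function.iterate_succ_apply']; exact aux_pdy_smooth ih

lemma aux_pdx_iter_smooth {F : ℝ × ℝ → ℝ} (hF : ContDiff ℝ ∞ F) (m : ℕ) :
    ContDiff ℝ ∞ (pdx^[m] F) := by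
  induction m with
  | zero => exact hF
  | succ m ih => rw [Function.iterate_succ_apply']; exact aux_pdx_smooth ih

lemma aux_pdmix_smooth {F : ℝ × ℝ → ℝ} (hF : ContDiff ℝ ∞ F) (l m : ℕ) :
    ContDiff ℝ ∞ (pdmix l m F) := aux_pdx_iter_smooth (aux_pdy_iter_smooth hF m) l

lemma aux_comm_iter {F : ℝ × ℝ → ℝ} (hF : ContDiff ℝ ∞ F) (l : ℕ) :
    pdy (pdx^[l] F) = pdx^[l] (pdy F) := by
  induction l with
  | zero => rfl
  | succ l ih =>
    rw [Function.iterate_succ_apply', Function.iterate_succ_apply',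
      aux_comm (aux_pdx_iter_smooth hF l), ih]

lemma aux_pdx_pdmix (F : ℝ × ℝ → ℝ) (l m : ℕ) : pdx (pdmix l m F) = pdmix (l + 1) m F := by
  simp only [pdmix, Function.iterate_succ_apply']

lemma aux_pdy_pdmix {F : ℝ × ℝ → ℝ} (hF : ContDiff ℝ ∞ F) (l m : ℕ) :
    pdy (pdmix l m F) = pdmix l (m + 1) F := by
  simp only [pdmix]
  rw [aux_comm_iter (aux_pdy_iter_smooth hF m), Function.iterate_succ_apply']

lemma aux_line_deriv {F : ℝ × ℝ → ℝ} (hF : ContDiff ℝ ∞ F) (μ x : ℝ) :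
    HasDerivAt (fun x => F (x, μ * x)) (pdx F (x, μ * x) + μ * pdy F (x, μ * x)) x := by
  have h1 : HasFDerivAt F (fderiv ℝ F (x, μ * x)) (x, μ * x) :=
    (hF.differentiable (by simp) _).hasFDerivAt
  have h2 := h1.comp_hasDerivAt x
    ((hasDerivAt_id x).prodMk ((hasDerivAt_id x).const_mul μ))
  refine h2.congr_deriv ?_
  rw [aux_pdx_eq hF, aux_pdy_eq hF]
  have : ((1:ℝ), μ * 1) = (1, 0) + μ • ((0:ℝ), (1:ℝ)) := by simp
  rw [this, map_add, map_smul, smul_eq_mul]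

lemma aux_iter {F : ℝ × ℝ → ℝ} (hF : ContDiff ℝ ∞ F) (μ : ℝ) (n : ℕ) :
    iteratedDeriv n (fun x => F (x, μ * x)) = fun x =>
      ∑ ij ∈ Finset.HasAntidiagonal.antidiagonal n,
        (n.choose ij.1 : ℝ) * (μ ^ ij.2 * pdmix ij.1 ij.2 F (x, μ * x)) := by
  induction n with
  | zero => funext x; simp [pdmix]
  | succ n ih =>
    rw [iteratedDeriv_succ, ih]
    funext x
    rw [Finset.sum_antidiagonal_choose_succ_mul
      (fun i j => μ ^ j * pdmix i j F (x, μ * x)) n]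
    have h : HasDerivAt (fun x => ∑ ij ∈ Finset.HasAntidiagonal.antidiagonal n,
        (n.choose ij.1 : ℝ) * (μ ^ ij.2 * pdmix ij.1 ij.2 F (x, μ * x)))
        (∑ ij ∈ Finset.HasAntidiagonal.antidiagonal n, (n.choose ij.1 : ℝ) * (μ ^ ij.2 *
          (pdmix (ij.1 + 1) ij.2 F (x, μ * x) + μ * pdmix ij.1 (ij.2 + 1) F (x, μ * x)))) x := by
      refine HasDerivAt.fun_sum fun ij _ => ?_
      have := aux_line_deriv (aux_pdmix_smooth hF ij.1 ij.2) μ x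
      rw [aux_pdx_pdmix, aux_pdy_pdmix hF] at this
      exact (this.const_mul _).const_mul _
    rw [h.deriv, ← Finset.sum_add_distrib]
    refine Finset.sum_congr rfl fun ij hij => ?_
    have hc : n.choose ij.2 = n.choose ij.1 :=
      (Nat.choose_symm_of_eq_add (Finset.HasAntidiagonal.mem_antidiagonal.1 hij).symm).symm
    rw [hc]
    ring

lemma aux_pdx_congr {F G : ℝ × ℝ → ℝ} {c : ℝ × ℝ} (h : F =ᶠ[𝓝 c] G) : pdx F =ᶠ[𝓝 c] pdx G := by
  filter_upwards [h.eventually_nhds] with p hp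
  refine Filter.EventuallyEq.deriv_eq ?_
  have : Tendsto (fun t : ℝ => (t, p.2)) (𝓝 p.1) (𝓝 p) :=
    (Continuous.tendsto (by fun_prop) p.1)
  exact this.eventually hp

lemma aux_pdy_congr {F G : ℝ × ℝ → ℝ} {c : ℝ × ℝ} (h : F =ᶠ[𝓝 c] G) : pdy F =ᶠ[𝓝 c] pdy G := by
  filter_upwards [h.eventually_nhds] with p hp
  refine Filter.EventuallyEq.deriv_eq ?_
  have : Tendsto (fun t : ℝ => (p.1, t)) (𝓝 p.2) (𝓝 p) :=
    (Continuous.tendsto (by fun_prop) p.2)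
  exact this.eventually hp

lemma aux_pdmix_congr {F G : ℝ × ℝ → ℝ} {c : ℝ × ℝ} (h : F =ᶠ[𝓝 c] G) (l m : ℕ) :
    pdmix l m F =ᶠ[𝓝 c] pdmix l m G := by
  have hy : pdy^[m] F =ᶠ[𝓝 c] pdy^[m] G := by
    induction m with
    | zero => exact h
    | succ m ih => simp only [Function.iterate_succ_apply']; exact aux_pdy_congr ih
  unfold pdmix
  induction l with
  | zero => exact hy
  | succ m ih => simp only [Function.iterate_succ_apply']; exact aux_pdx_congr ih

/-- The function `g_μ(x) = a₁(x, μx) + μ a₂(x, μx)` admits an asymptotic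
expansion `g_μ(x) ~ Σ_{n ≥ 0} x^n (c_n(μ) + d_n(μ) ln x)` as `x → 0⁺`, where
`d_n(μ) = −(1/(2π n!)) Σ_{ℓ=0}^{n+1} C(n+1, ℓ) μ^{n+1−ℓ} ∂_x^ℓ ∂_y^{n+1−ℓ} f_r(0)`. -/
theorem asymptotic_expansion_of_g_mu
    (V : Set (ℝ × ℝ)) (hV : IsOpen V) (h0V : ((0 : ℝ), (0 : ℝ)) ∈ V)
    (fr σ₁ σ₂ : ℝ × ℝ → ℝ)
    (hfr : ContDiffOn ℝ (⊤ : ℕ∞) fr V) (hσ₁ : ContDiffOn ℝ (⊤ : ℕ∞) σ₁ V) (hσ₂ : ContDiffOn ℝ (⊤ : ℕ∞) σ₂ V)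
    (hfr0 : fr (0, 0) = 0)
    (μ : ℝ) (hμ : 0 < μ) :
    ∃ c d : ℕ → ℝ,
      (∀ N : ℕ, ∃ C > (0 : ℝ), ∃ δ > (0 : ℝ), ∀ x ∈ Set.Ioo (0 : ℝ) δ,
        |(aOne fr σ₁ σ₂ (x, μ * x) + μ * aTwo fr σ₂ (x, μ * x)) -
            ∑ n ∈ Finset.range (N + 1), x ^ n * (c n + d n * Real.log x)|
          ≤ C * x ^ (N + 1) * |Real.log x|) ∧
      (∀ n : ℕ, d n = -(1 / (2 * Real.pi * (n.factorial : ℝ))) *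
        ∑ l ∈ Finset.range (n + 2),
          ((n + 1).choose l : ℝ) * μ ^ (n + 1 - l) * pdmix l (n + 1 - l) fr (0, 0)) := by
  obtain ⟨F, hF, hFe⟩ := aux_globalize hV h0V hfr
  obtain ⟨T₁, hT₁, hT₁e⟩ := aux_globalize hV h0V hσ₁
  obtain ⟨T₂, hT₂, hT₂e⟩ := aux_globalize hV h0V hσ₂
  have hline : ContDiff ℝ ∞ (fun x : ℝ => (x, μ * x)) := by fun_prop
  set H : ℝ → ℝ := fun x => F (x, μ * x) with hHdef
  have hH : ContDiff ℝ ∞ H := hF.comp hline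
  have hH0 : H 0 = 0 := by
    have := hFe.eq_of_nhds
    simp only [hHdef, mul_zero, this, hfr0]
  obtain ⟨k, hk, hHk⟩ := aux_hadamard hH hH0
  have hH' : ContDiff ℝ ∞ (deriv H) := (contDiff_infty_iff_deriv.1 hH).2
  have hpos : ∀ x, 1 + k x ^ 2 ≠ 0 := fun x => by positivity
  set A : ℝ → ℝ := fun x => T₁ (x, μ * x) - (1 / (2 * Real.pi)) * Real.arctan (k x) +
    (T₂ (x, μ * x) - (1 / (4 * Real.pi)) * Real.log (1 + k x ^ 2)) * deriv H x with hAdef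
  have hA : ContDiff ℝ ∞ A := by
    have h1 : ContDiff ℝ ∞ (fun x : ℝ => T₁ (x, μ * x)) := hT₁.comp hline
    have h2 : ContDiff ℝ ∞ (fun x : ℝ => T₂ (x, μ * x)) := hT₂.comp hline
    have h3 : ContDiff ℝ ∞ (fun x => Real.arctan (k x)) := hk.arctan
    have h4 : ContDiff ℝ ∞ (fun x => Real.log (1 + k x ^ 2)) :=
      (contDiff_const.add (hk.pow 2)).log hpos
    exact (h1.sub (contDiff_const.mul h3)).add ((h2.sub (contDiff_const.mul h4)).mul hH')
  -- the decomposition near zero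
  have hg : ∀ᶠ x in 𝓝 (0:ℝ), 0 < x →
      aOne fr σ₁ σ₂ (x, μ * x) + μ * aTwo fr σ₂ (x, μ * x) =
        A x - (1 / (2 * Real.pi)) * deriv H x * Real.log x := by
    have ht : Tendsto (fun x : ℝ => (x, μ * x)) (𝓝 0) (𝓝 (0, 0)) := by
      have := hline.continuous.tendsto 0
      simpa using this
    filter_upwards [ht.eventually hFe, ht.eventually hT₁e, ht.eventually hT₂e,
      ht.eventually (aux_pdx_congr hFe), ht.eventually (aux_pdy_congr hFe)]
      with x e1 e2 e3 e4 e5 hx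
    have hd : deriv H x = pdx F (x, μ * x) + μ * pdy F (x, μ * x) := (aux_line_deriv hF μ x).deriv
    have e1' : fr (x, μ * x) = x * k x := by rw [← e1, ← hHk]
    have hlog : Real.log (x ^ 2 + (x * k x) ^ 2) = 2 * Real.log x + Real.log (1 + k x ^ 2) := by
      rw [show x ^ 2 + (x * k x) ^ 2 = x ^ 2 * (1 + k x ^ 2) by ring,
        Real.log_mul (by positivity) (hpos x), Real.log_pow]
      norm_num
    simp only [aOne, aTwo, tau₁, tau₂, hAdef]
    rw [e1', hlog, hd, e2, e3, e4, e5, mul_div_cancel_left₀ _ hx.ne']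
    field_simp
    ring
  refine ⟨fun n => iteratedDeriv n A 0 / n.factorial,
    fun n => -(1 / (2 * Real.pi)) * (iteratedDeriv n (deriv H) 0 / n.factorial), ?_, ?_⟩
  · intro N
    obtain ⟨C₁, hC₁⟩ := aux_taylor hA N
    obtain ⟨C₂, hC₂⟩ := aux_taylor hH' N
    obtain ⟨δ, hδ, hg⟩ := Metric.eventually_nhds_iff.1 hg
    refine ⟨|C₁| + (1 / (2 * Real.pi)) * |C₂| + 1, by positivity, min δ (Real.exp (-1)),
      lt_min hδ (Real.exp_pos _), fun x hx => ?_⟩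
    have hx0 : 0 < x := hx.1
    have hxδ : x < δ := hx.2.trans_le (min_le_left _ _)
    have hxe : x < Real.exp (-1) := hx.2.trans_le (min_le_right _ _)
    have hl : Real.log x < -1 := (Real.log_lt_iff_lt_exp hx0).2 hxe
    have hl1 : 1 ≤ |Real.log x| := by rw [abs_of_neg (by linarith)]; linarith
    have hx1 : x ≤ 1 := hxe.le.trans (Real.exp_le_one_iff.2 (by norm_num))
    rw [hg (by simpa [abs_of_pos hx0] using hxδ) hx0]
    have b1 := hC₁ x ⟨hx0.le, hx1⟩
    have b2 := hC₂ x ⟨hx0.le, hx1⟩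
    set P := ∑ n ∈ Finset.range (N + 1), x ^ n * (iteratedDeriv n A 0 / n.factorial) with hP
    set Q := ∑ n ∈ Finset.range (N + 1), x ^ n * (iteratedDeriv n (deriv H) 0 / n.factorial)
      with hQ
    have hsum : ∑ n ∈ Finset.range (N + 1), x ^ n * (iteratedDeriv n A 0 / n.factorial +
        -(1 / (2 * Real.pi)) * (iteratedDeriv n (deriv H) 0 / n.factorial) * Real.log x) =
        P - (1 / (2 * Real.pi)) * Q * Real.log x := by
      rw [hP, hQ, Finset.mul_sum, Finset.sum_mul, ← Finset.sum_sub_distrib]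
      exact Finset.sum_congr rfl fun n _ => by ring
    rw [hsum, show A x - (1 / (2 * Real.pi)) * deriv H x * Real.log x -
      (P - (1 / (2 * Real.pi)) * Q * Real.log x) =
      (A x - P) - (1 / (2 * Real.pi)) * (deriv H x - Q) * Real.log x by ring]
    have hxp : 0 < x ^ (N + 1) := by positivity
    have hpi : 0 < 1 / (2 * Real.pi) := by positivity
    calc |(A x - P) - (1 / (2 * Real.pi)) * (deriv H x - Q) * Real.log x|
        ≤ |A x - P| + |(1 / (2 * Real.pi)) * (deriv H x - Q) * Real.log x| := abs_sub _ _
      _ = |A x - P| + (1 / (2 * Real.pi)) * |deriv H x - Q| * |Real.log x| := by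
          rw [abs_mul, abs_mul, abs_of_pos hpi]
      _ ≤ |C₁| * x ^ (N + 1) * |Real.log x| +
          (1 / (2 * Real.pi)) * (|C₂| * x ^ (N + 1)) * |Real.log x| := by
          have c1 : |A x - P| ≤ |C₁| * x ^ (N + 1) :=
            b1.trans (mul_le_mul_of_nonneg_right (le_abs_self _) hxp.le)
          have c2 : |deriv H x - Q| ≤ |C₂| * x ^ (N + 1) :=
            b2.trans (mul_le_mul_of_nonneg_right (le_abs_self _) hxp.le)
          have c3 : |C₁| * x ^ (N + 1) ≤ |C₁| * x ^ (N + 1) * |Real.log x| :=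
            le_mul_of_one_le_right (by positivity) hl1
          gcongr
          exact c1.trans c3
      _ ≤ (|C₁| + (1 / (2 * Real.pi)) * |C₂| + 1) * x ^ (N + 1) * |Real.log x| := by
          have : 0 ≤ x ^ (N + 1) * |Real.log x| := by positivity
          nlinarith
  · intro n
    have h1 : iteratedDeriv n (deriv H) 0 = ∑ l ∈ Finset.range (n + 2),
          ((n + 1).choose l : ℝ) * μ ^ (n + 1 - l) * pdmix l (n + 1 - l) fr (0, 0) := by
      rw [← iteratedDeriv_succ', hHdef, aux_iter hF μ (n + 1)]
      beta_reduce
      rw [Finset.Nat.sum_antidiagonal_eq_sum_range_succ_mk]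
      refine Finset.sum_congr rfl fun l _ => ?_
      simp only [mul_zero]
      rw [(aux_pdmix_congr hFe l (n + 1 - l)).eq_of_nhds]
      ring
    simp only [h1]
    field_simp
end
end
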